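/- Let γ be a simple closed curve in S². Then S² \ γ has exactly two connected components, and the closure of each component is homeomorphic to the closed two-dimensional disk. -/

import Mathlib

open Metric Set

/-- The plane `ℝ²`. -/
abbrev Plane := EuclideanSpace ℝ (Fin 2)

/-- The 2-sphere, as the unit sphere in `ℝ³`. -/
abbrev Sph := Metric.sphere (0 : EuclideanSpace ℝ (Fin 3)) 1

/-- The unit circle in the plane. -/
abbrev Circle2 := Metric.sphere (0 : Plane) 1

namespace Schoenflies

section Logarithms

open Complex

variable {X : Type*} [TopologicalSpace X] {S T : Set X} {g h : X → ℂ}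

/-- `g` has a continuous branch of logarithm on `S`. -/
def HasLogOn (g : X → ℂ) (S : Set X) : Prop :=
  ∃ f : X → ℂ, ContinuousOn f S ∧ ∀ x ∈ S, exp (f x) = g x

lemma HasLogOn.mono (hg : HasLogOn g T) (hST : S ⊆ T) : HasLogOn g S :=
  let ⟨f, hf, hfg⟩ := hg
  ⟨f, hf.mono hST, fun x hx ↦ hfg x (hST hx)⟩

lemma HasLogOn.congr (hg : HasLogOn g S) (h_eq : EqOn h g S) : HasLogOn h S :=
  let ⟨f, hf, hfg⟩ := hg
  ⟨f, hf, fun x hx ↦ (hfg x hx).trans (h_eq hx).symm⟩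

lemma HasLogOn.mul (hg : HasLogOn g S) (hh : HasLogOn h S) :
    HasLogOn (fun x ↦ g x * h x) S := by
  obtain ⟨f, hf, hfg⟩ := hg
  obtain ⟨k, hk, hkh⟩ := hh
  exact ⟨fun x ↦ f x + k x, hf.add hk, fun x hx ↦ by rw [exp_add, hfg x hx, hkh x hx]⟩

lemma HasLogOn.inv (hg : HasLogOn g S) : HasLogOn (fun x ↦ (g x)⁻¹) S := by
  obtain ⟨f, hf, hfg⟩ := hg
  exact ⟨fun x ↦ -f x, hf.neg, fun x hx ↦ by rw [exp_neg, hfg x hx]⟩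

lemma HasLogOn.div (hg : HasLogOn g S) (hh : HasLogOn h S) :
    HasLogOn (fun x ↦ g x / h x) S := by
  simpa only [div_eq_mul_inv] using hg.mul hh.inv

lemma HasLogOn.comp {Y : Type*} [TopologicalSpace Y] {k : Y → X} {R : Set Y}
    (hg : HasLogOn g S) (hk : ContinuousOn k R) (hRS : MapsTo k R S) :
    HasLogOn (g ∘ k) R := by
  obtain ⟨f, hf, hfg⟩ := hg
  exact ⟨f ∘ k, hf.comp hk hRS, fun x hx ↦ hfg _ (hRS hx)⟩

lemma hasLogOn_of_norm_sub_one_lt (hg : ContinuousOn g S) (h1 : ∀ x ∈ S, ‖g x - 1‖ < 1) :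
    HasLogOn g S := by
  have hs : ∀ x ∈ S, g x ∈ slitPlane := fun x hx ↦
    ball_one_subset_slitPlane (by simpa [mem_ball, dist_eq_norm] using h1 x hx)
  exact ⟨fun x ↦ log (g x), hg.clog hs, fun x hx ↦ exp_log (slitPlane_ne_zero (hs x hx))⟩

lemma hasLogOn_const {c : ℂ} (hc : c ≠ 0) : HasLogOn (fun _ : X ↦ c) S :=
  ⟨fun _ ↦ log c, continuousOn_const, fun _ _ ↦ exp_log hc⟩

lemma hasLogOn_of_simplyConnected [SimplyConnectedSpace X] [LocallyPathConnectedSpace X]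
    (hg : Continuous g) (h0 : ∀ x, g x ≠ 0) : HasLogOn g univ := by
  obtain ⟨x₀⟩ : Nonempty X := inferInstance
  obtain ⟨f, ⟨-, hf⟩, -⟩ := isCoveringMapOn_exp.existsUnique_continuousMap_lifts
    ⟨g, hg⟩ (exp_log (h0 x₀)) (fun x ↦ h0 x)
  exact ⟨f, f.continuous.continuousOn, fun x _ ↦ congrFun hf x⟩

/-- Two continuous logarithms of the same function on a preconnected set differ by a constant. -/
lemma sub_eq_sub_of_exp_eq (hS : IsPreconnected S) {f k : X → ℂ} (hf : ContinuousOn f S)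
    (hk : ContinuousOn k S) (hfk : ∀ x ∈ S, exp (f x) = exp (k x)) {x y : X}
    (hx : x ∈ S) (hy : y ∈ S) : f x - k x = f y - k y := by
  have hd : IsDiscrete (AddSubgroup.zmultiples (2 * Real.pi * I) : Set ℂ) :=
    ⟨NormedSpace.discreteTopology_zmultiples _⟩
  refine hS.constant_of_mapsTo hd (hf.sub hk) (fun z hz ↦ ?_) hx hy
  obtain ⟨n, hn⟩ := exp_eq_exp_iff_exists_int.1 (hfk z hz)
  exact ⟨n, by simp [hn]⟩

lemma exists_eq_add_const_of_exp_eq (hS : IsPreconnected S) {f k : X → ℂ} (hf : ContinuousOn f S)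
    (hk : ContinuousOn k S) (hfk : ∀ x ∈ S, exp (f x) = exp (k x)) :
    ∃ c, exp c = 1 ∧ ∀ x ∈ S, f x = k x + c := by
  rcases S.eq_empty_or_nonempty with rfl | ⟨x₀, hx₀⟩
  · exact ⟨0, by simp⟩
  · refine ⟨f x₀ - k x₀, ?_, fun x hx ↦ ?_⟩
    · rw [exp_sub, hfk x₀ hx₀, div_self (exp_ne_zero _)]
    · rw [← sub_eq_sub_of_exp_eq hS hf hk hfk hx hx₀]; ring

/-- Logarithms on two sets with preconnected intersection can be glued. -/
lemma HasLogOn.union (hST : IsPreconnected (S ∩ T))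
    (hcl : (IsClosed S ∧ IsClosed T) ∨ (IsOpen S ∧ IsOpen T))
    (hS : HasLogOn g S) (hT : HasLogOn g T) : HasLogOn g (S ∪ T) := by
  classical
  obtain ⟨f, hf, hfg⟩ := hS
  obtain ⟨k, hk, hkg⟩ := hT
  obtain ⟨c, hc, hfk⟩ := exists_eq_add_const_of_exp_eq hST (hf.mono inter_subset_left)
    (hk.mono inter_subset_right) fun x hx ↦ (hfg x hx.1).trans (hkg x hx.2).symm
  have h1 : EqOn (S.piecewise f fun x ↦ k x + c) f S := fun x hx ↦ by simp [hx]
  have h2 : EqOn (S.piecewise f fun x ↦ k x + c) (fun x ↦ k x + c) T := fun x hx ↦ by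
    by_cases hxS : x ∈ S
    · simp [hxS, hfk x ⟨hxS, hx⟩]
    · simp [hxS]
  refine ⟨S.piecewise f fun x ↦ k x + c, ?_, ?_⟩
  · have c1 := hf.congr h1
    have c2 := (hk.add continuousOn_const).congr h2
    rcases hcl with ⟨h3, h4⟩ | ⟨h3, h4⟩
    · exact c1.union_of_isClosed c2 h3 h4
    · exact c1.union_of_isOpen c2 h3 h4
  · rintro x (hx | hx)
    · rw [h1 hx, hfg x hx]
    · rw [h2 hx, exp_add, hc, mul_one, hkg x hx]

/-- A power of the angular coordinate has no continuous logarithm on a circle. -/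
lemma eq_zero_of_hasLogOn_sphere {p : ℂ} {R : ℝ} (hR : 0 < R) {n : ℤ}
    (h : HasLogOn (fun z ↦ (z - p) ^ n) (sphere p R)) : n = 0 := by
  obtain ⟨f, hf, hfg⟩ := h
  have hmem : ∀ t : ℝ, p + R * exp (t * I) ∈ sphere p R := fun t ↦ by
    simp [norm_exp_ofReal_mul_I, abs_of_pos hR]
  have h1 : ContinuousOn (fun t : ℝ ↦ f (p + R * exp (t * I))) univ :=
    hf.comp (by fun_prop) fun t _ ↦ hmem t
  have h2 : ContinuousOn (fun t : ℝ ↦ n * (log R + t * I)) univ := by fun_prop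
  have h3 := sub_eq_sub_of_exp_eq isPreconnected_univ h1 h2 (fun t _ ↦ by
    rw [hfg _ (hmem t), exp_int_mul, exp_add, exp_log (by exact_mod_cast hR.ne')]
    simp) (mem_univ 0) (mem_univ (2 * Real.pi))
  have h4 : exp (((2 * Real.pi : ℝ) : ℂ) * I) = exp (((0 : ℝ) : ℂ) * I) := by
    simp [exp_two_pi_mul_I]
  simp only [h4] at h3
  have h5 : (n : ℂ) * (2 * Real.pi * I) = 0 := by
    push_cast at h3
    linear_combination h3
  simpa [Real.pi_ne_zero, I_ne_zero] using h5

end Logarithms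

section Separation

open Complex Bornology

/-- A point of a bounded open set contributes to the obstruction to the existence of a logarithm
on the frontier of the set. -/
lemma eq_zero_of_hasLogOn_frontier {U : Set ℂ} (hU : IsOpen U) (hb : IsBounded U) {p : ℂ}
    (hp : p ∈ U) {n : ℤ} {h : ℂ → ℂ} (hh : ContinuousOn h (closure U))
    (h0 : ∀ z ∈ closure U, h z ≠ 0)
    (hlog : HasLogOn (fun z ↦ (z - p) ^ n * h z) (frontier U)) : n = 0 := by
  classical
  obtain ⟨f, hf, hfg⟩ := hlog
  obtain ⟨F, hF⟩ := ContinuousMap.exists_restrict_eq isClosed_frontier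
    ⟨_, continuousOn_iff_continuous_domRestrict.1 hf⟩
  have hFf : ∀ z ∈ frontier U, F z = f z := fun z hz ↦ DFunLike.congr_fun hF ⟨z, hz⟩
  let Φ : ℂ → ℂ := U.piecewise (fun z ↦ exp (F z) / h z) fun z ↦ (z - p) ^ n
  have hne : ∀ z ∉ U, z - p ≠ 0 := fun z hz h ↦ hz (by rwa [sub_eq_zero.1 h])
  have hΦ : Continuous Φ := by
    rw [← continuousOn_univ]
    refine ContinuousOn.piecewise (fun z hz ↦ ?_) ?_ ?_
    · have hz' := hz.2
      rw [hFf z hz', hfg z hz', mul_div_cancel_right₀ _ (h0 z (frontier_subset_closure hz'))]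
    · rw [univ_inter]
      exact F.continuous.cexp.continuousOn.div hh h0
    · rw [univ_inter, hU.isClosed_compl.closure_eq]
      exact (continuousOn_id.sub continuousOn_const).zpow₀ n fun z hz ↦ Or.inl (hne z hz)
  have hΦ0 : ∀ z, Φ z ≠ 0 := fun z ↦ by
    by_cases hz : z ∈ U
    · simpa [Φ, hz] using h0 z (subset_closure hz)
    · simpa only [Φ, piecewise_eq_of_notMem _ _ _ hz] using zpow_ne_zero n (hne z hz)
  obtain ⟨R, hR, hUR⟩ := hb.subset_ball_lt 0 p
  refine eq_zero_of_hasLogOn_sphere hR (p := p)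
    (((hasLogOn_of_simplyConnected hΦ hΦ0).mono (subset_univ _)).congr fun z hz ↦ ?_)
  have : z ∉ U := fun hzU ↦ by
    have := hUR hzU
    rw [mem_ball] at this
    exact this.ne hz
  simp [Φ, this]

lemma isPreconnected_compl_closedBall (c : ℂ) {R : ℝ} (hR : 0 < R) :
    IsPreconnected (closedBall c R)ᶜ := by
  have : (closedBall c R)ᶜ = (fun z ↦ c + exp z) '' {z | Real.log R < z.re} := by
    ext w
    simp only [mem_compl_iff, mem_closedBall, dist_eq_norm, not_le, mem_image, mem_ofPred_eq]
    constructor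
    · intro hw
      refine ⟨log (w - c), ?_, ?_⟩
      · rw [log_re]
        exact Real.log_lt_log hR hw
      · rw [exp_log (norm_pos_iff.1 (hR.trans hw))]; ring
    · rintro ⟨z, hz, rfl⟩
      rw [add_sub_cancel_left, norm_exp]
      exact (Real.log_lt_iff_lt_exp hR).1 hz
  rw [this]
  exact (convex_halfSpace_re_gt _).isPreconnected.image _ (by fun_prop)

end Separation

section Janiszewski

open Complex Bornology

lemma frontier_connectedComponentIn_compl_subset {K : Set ℂ} (hK : IsClosed K) (p : ℂ) :
    frontier (connectedComponentIn Kᶜ p) ⊆ K := by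
  intro x hx
  by_contra hxK
  have hU : IsOpen (connectedComponentIn Kᶜ p) := hK.isOpen_compl.connectedComponentIn
  rw [hU.frontier_eq] at hx
  obtain ⟨y, hy, hyp⟩ := mem_closure_iff.1 hx.1 _
    (hK.isOpen_compl.connectedComponentIn (x := x)) (mem_connectedComponentIn hxK)
  exact hx.2 (connectedComponentIn_eq hyp ▸ connectedComponentIn_eq hy ▸
    mem_connectedComponentIn hxK)

/-- A compact set in the plane has only one unbounded complementary component. -/
lemma mem_connectedComponentIn_of_not_isBounded {K : Set ℂ} (hK : IsCompact K) {p q : ℂ}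
    (hp : ¬ IsBounded (connectedComponentIn Kᶜ p))
    (hq : ¬ IsBounded (connectedComponentIn Kᶜ q)) : q ∈ connectedComponentIn Kᶜ p := by
  obtain ⟨R, hR, hKR⟩ := hK.isBounded.subset_closedBall_lt 0 0
  have key : ∀ {a}, ¬ IsBounded (connectedComponentIn Kᶜ a) →
      ∃ b ∈ connectedComponentIn Kᶜ a, b ∈ (closedBall (0 : ℂ) R)ᶜ := fun {a} ha ↦ by
    by_contra! h
    exact ha (isBounded_closedBall.subset fun b hb ↦ not_not.1 (h b hb))
  obtain ⟨a, hap, haR⟩ := key hp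
  obtain ⟨b, hbq, hbR⟩ := key hq
  have hsub := (isPreconnected_compl_closedBall 0 hR).subset_connectedComponentIn haR
    (compl_subset_compl.2 hKR)
  have hba := hsub hbR
  rw [connectedComponentIn_eq hap, connectedComponentIn_eq hba, ← connectedComponentIn_eq hbq]
  refine mem_connectedComponentIn fun hqK ↦ ?_
  rw [connectedComponentIn_eq_empty (not_not.2 hqK)] at hbq
  exact hbq

/-- If `p` and `q` are not separated by `K`, then `(z - p) / (z - q)` has a logarithm on `K`. -/
lemma hasLogOn_div_of_isPreconnected {K T : Set ℂ} (hK : IsCompact K) (hT : IsPreconnected T)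
    (hTK : T ⊆ Kᶜ) {p q : ℂ} (hp : p ∈ T) (hq : q ∈ T) :
    HasLogOn (fun z ↦ (z - p) / (z - q)) K := by
  have hne : ∀ {a z : ℂ}, a ∈ T → z ∈ K → z - a ≠ 0 := fun {a z} ha hz h ↦
    hTK ha (sub_eq_zero.1 h ▸ hz)
  refine hT.induction₂ (fun p q ↦ HasLogOn (fun z ↦ (z - p) / (z - q)) K) ?_ ?_ ?_ hp hq
  · intro a ha
    obtain ⟨ε, hε, hεK⟩ := Metric.isOpen_iff.1 hK.isClosed.isOpen_compl a (hTK ha)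
    filter_upwards [mem_nhdsWithin_of_mem_nhds (ball_mem_nhds a hε), self_mem_nhdsWithin]
      with b hb hbT
    have := (hasLogOn_of_norm_sub_one_lt (S := K) (g := fun z ↦ (z - b) / (z - a)) ?_ ?_).inv
    · simpa only [inv_div] using this
    · exact (by fun_prop : ContinuousOn (fun z ↦ z - b) K).div (by fun_prop)
        fun z hz ↦ hne ha hz
    · intro z hz
      have h1 : ε ≤ ‖z - a‖ := by
        by_contra! h
        exact hεK (mem_ball_iff_norm.2 h) hz
      rw [div_sub_one (hne ha hz), norm_div, div_lt_one (hε.trans_le h1)]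
      rw [mem_ball_iff_norm'] at hb
      calc ‖z - b - (z - a)‖ = ‖a - b‖ := by congr 1; ring
        _ < ‖z - a‖ := hb.trans_le h1
  · intro a b c ha hb hc hab hbc
    exact (hab.mul hbc).congr fun z hz ↦ (div_mul_div_cancel₀ (hne hb hz)).symm
  · intro a b ha hb hab
    simpa only [inv_div] using hab.inv

/-- If `(z - p) / (z - q)` has a logarithm on `K`, then `K` does not separate `p` and `q`. -/
lemma mem_connectedComponentIn_of_hasLogOn_div {K : Set ℂ} (hK : IsCompact K) {p q : ℂ}
    (hp : p ∉ K) (hq : q ∉ K) (h : HasLogOn (fun z ↦ (z - p) / (z - q)) K) :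
    q ∈ connectedComponentIn Kᶜ p := by
  have key : ∀ {a b : ℂ}, a ∉ K → b ∉ K → b ∉ connectedComponentIn Kᶜ a →
      IsBounded (connectedComponentIn Kᶜ a) → ¬ HasLogOn (fun z ↦ (z - a) / (z - b)) K := by
    intro a b ha hb hab hbd hlog
    have hfr := frontier_connectedComponentIn_compl_subset hK.isClosed a
    have hne : ∀ z ∈ closure (connectedComponentIn Kᶜ a), z - b ≠ 0 := by
      intro z hz h0
      rw [sub_eq_zero.1 h0, closure_eq_self_union_frontier] at hz
      exact hz.elim hab fun h ↦ hb (hfr h)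
    refine one_ne_zero (eq_zero_of_hasLogOn_frontier hK.isClosed.isOpen_compl.connectedComponentIn
      hbd (mem_connectedComponentIn ha) (n := 1) (h := fun z ↦ (z - b)⁻¹)
      (ContinuousOn.inv₀ (by fun_prop) hne) (fun z hz ↦ inv_ne_zero (hne z hz)) ?_)
    simpa only [zpow_one, ← div_eq_mul_inv] using hlog.mono hfr
  by_contra hpq
  by_cases h1 : IsBounded (connectedComponentIn Kᶜ p)
  · exact key hp hq hpq h1 h
  by_cases h2 : IsBounded (connectedComponentIn Kᶜ q)
  · refine key hq hp (fun hqp ↦ hpq ?_) h2 (by simpa only [inv_div] using h.inv)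
    rw [← connectedComponentIn_eq hqp]
    exact mem_connectedComponentIn hq
  · exact hpq (mem_connectedComponentIn_of_not_isBounded hK h1 h2)

/-- **Janiszewski's theorem**: if neither `A` nor `B` separates `p` and `q`, and `A ∩ B` is
connected, then `A ∪ B` does not separate `p` and `q`. -/
theorem mem_connectedComponentIn_compl_union {A B : Set ℂ} (hA : IsCompact A) (hB : IsCompact B)
    (hAB : IsPreconnected (A ∩ B)) {p q : ℂ} (hpA : q ∈ connectedComponentIn Aᶜ p)
    (hpB : q ∈ connectedComponentIn Bᶜ p) : q ∈ connectedComponentIn (A ∪ B)ᶜ p := by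
  have key : ∀ {K : Set ℂ}, IsCompact K → q ∈ connectedComponentIn Kᶜ p →
      p ∉ K ∧ q ∉ K ∧ HasLogOn (fun z ↦ (z - p) / (z - q)) K := fun {K} hK h ↦ by
    have hp : p ∈ Kᶜ := by
      by_contra hp
      rw [connectedComponentIn_eq_empty hp] at h
      exact h
    exact ⟨hp, connectedComponentIn_subset _ _ h, hasLogOn_div_of_isPreconnected hK
      isPreconnected_connectedComponentIn (connectedComponentIn_subset _ _)
      (mem_connectedComponentIn hp) h⟩
  obtain ⟨hp1, hq1, h1⟩ := key hA hpA
  obtain ⟨hp2, hq2, h2⟩ := key hB hpB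
  exact mem_connectedComponentIn_of_hasLogOn_div (hA.union hB) (by simp [hp1, hp2])
    (by simp [hq1, hq2]) (h1.union hAB (Or.inl ⟨hA.isClosed, hB.isClosed⟩) h2)

end Janiszewski

/-- `γ` is a `1`-periodic parametrization of a simple closed curve. -/
structure IsJordan (γ : ℝ → ℂ) : Prop where
  continuous : Continuous γ
  eq_iff : ∀ s t, γ s = γ t ↔ ∃ k : ℤ, s = t + k

namespace IsJordan

open Complex Bornology

lemma add_int {γ : ℝ → ℂ} (hγ : IsJordan γ) (t : ℝ) (k : ℤ) : γ (t + k) = γ t :=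
  (hγ.eq_iff _ _).2 ⟨k, rfl⟩

lemma add_one {γ : ℝ → ℂ} (hγ : IsJordan γ) (t : ℝ) : γ (t + 1) = γ t := by
  simpa using hγ.add_int t 1

lemma image_Ico {γ : ℝ → ℂ} (hγ : IsJordan γ) (t₀ : ℝ) : γ '' Ico t₀ (t₀ + 1) = range γ := by
  refine (image_subset_range _ _).antisymm ?_
  rintro _ ⟨t, rfl⟩
  obtain ⟨k, hk, -⟩ := existsUnique_add_zsmul_mem_Ico one_pos t t₀
  exact ⟨_, hk, by simpa using hγ.add_int t k⟩

lemma image_Icc {γ : ℝ → ℂ} (hγ : IsJordan γ) (t₀ : ℝ) : γ '' Icc t₀ (t₀ + 1) = range γ :=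
  (image_subset_range _ _).antisymm <| (hγ.image_Ico t₀).symm.trans_subset
    (image_mono Ico_subset_Icc_self)

lemma injOn_Ico {γ : ℝ → ℂ} (hγ : IsJordan γ) (t₀ : ℝ) : InjOn γ (Ico t₀ (t₀ + 1)) := by
  intro s hs t ht hst
  obtain ⟨k, rfl⟩ := (hγ.eq_iff _ _).1 hst
  have h1 : (k : ℝ) < 1 := by linarith [hs.2, ht.1]
  have h2 : (-1 : ℝ) < k := by linarith [hs.1, ht.2]
  have : k = 0 := by
    have h1' : k < 1 := by exact_mod_cast h1
    have h2' : -1 < k := by exact_mod_cast h2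
    omega
  simp [this]

lemma isCompact_range {γ : ℝ → ℂ} (hγ : IsJordan γ) : IsCompact (range γ) := by
  rw [← hγ.image_Icc 0]
  exact isCompact_Icc.image hγ.continuous

lemma isConnected_range {γ : ℝ → ℂ} (hγ : IsJordan γ) : IsConnected (range γ) :=
  _root_.isConnected_range hγ.continuous

lemma isPreconnected_range_diff {γ : ℝ → ℂ} (hγ : IsJordan γ) (t₀ : ℝ) :
    IsPreconnected (range γ \ {γ t₀}) := by
  have : range γ \ {γ t₀} = γ '' Ioo t₀ (t₀ + 1) := by
    rw [← hγ.image_Ico t₀, ← Ico_sdiff_left, (hγ.injOn_Ico t₀).image_sdiff_subset, image_singleton]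
    simp
  rw [this]
  exact isPreconnected_Ioo.image _ hγ.continuous.continuousOn

/-- A logarithm along a curve descends to a logarithm on the trace of the curve. -/
lemma _root_.Schoenflies.hasLogOn_image {γ : ℝ → ℂ} {K : Set ℝ} (hK : IsCompact K)
    (hγ : ContinuousOn γ K) {g : ℂ → ℂ} {F : ℝ → ℂ} (hF : ContinuousOn F K)
    (hFγ : ∀ s ∈ K, ∀ t ∈ K, γ s = γ t → F s = F t) (hFg : ∀ t ∈ K, exp (F t) = g (γ t)) :
    HasLogOn g (γ '' K) := by
  classical
  let f : ℂ → ℂ := fun z ↦ if h : ∃ t ∈ K, γ t = z then F h.choose else 0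
  have hf : ∀ t ∈ K, f (γ t) = F t := fun t ht ↦ by
    have h : ∃ s ∈ K, γ s = γ t := ⟨t, ht, rfl⟩
    simp only [f, dif_pos h]
    exact hFγ _ h.choose_spec.1 _ ht h.choose_spec.2
  refine ⟨f, ?_, ?_⟩
  · rw [continuousOn_iff_continuous_domRestrict]
    have := isCompact_iff_compactSpace.1 hK
    let π : K → γ '' K := fun t ↦ ⟨γ t, mem_image_of_mem γ t.2⟩
    have hπ : Continuous π := (continuousOn_iff_continuous_domRestrict.1 hγ).subtype_mk _
    have hs : Function.Surjective π := by
      rintro ⟨_, t, ht, rfl⟩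
      exact ⟨⟨t, ht⟩, rfl⟩
    rw [(hπ.isClosedMap.isQuotientMap hπ hs).continuous_iff]
    convert! continuousOn_iff_continuous_domRestrict.1 hF using 1
    ext t
    exact hf t t.2
  · rintro _ ⟨t, ht, rfl⟩
    rw [hf t ht, hFg t ht]

lemma exists_log {γ : ℝ → ℂ} (hγ : IsJordan γ)
    {g : ℂ → ℂ} (hg : ContinuousOn g (range γ)) (h0 : ∀ z ∈ range γ, g z ≠ 0) :
    ∃ F : ℝ → ℂ, Continuous F ∧ ∀ t, exp (F t) = g (γ t) := by
  obtain ⟨F, hF, hFg⟩ := hasLogOn_of_simplyConnected (X := ℝ) (g := g ∘ γ)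
    (hg.comp_continuous hγ.continuous fun t ↦ mem_range_self t)
    fun t ↦ h0 _ (mem_range_self t)
  exact ⟨F, continuousOn_univ.1 hF, fun t ↦ hFg t (mem_univ t)⟩

/-- Nonvanishing functions have logarithms on proper compact subsets of a Jordan curve. -/
lemma hasLogOn_of_notMem {γ : ℝ → ℂ} (hγ : IsJordan γ)
    {K : Set ℂ} (hK : IsClosed K) (hKγ : K ⊆ range γ) {t₀ : ℝ}
    (ht₀ : γ t₀ ∉ K) {g : ℂ → ℂ} (hg : ContinuousOn g (range γ)) (h0 : ∀ z ∈ range γ, g z ≠ 0) :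
    HasLogOn g K := by
  obtain ⟨F, hF, hFg⟩ := hγ.exists_log hg h0
  have hKt : IsCompact (Icc t₀ (t₀ + 1) ∩ γ ⁻¹' K) :=
    isCompact_Icc.inter_right (hK.preimage hγ.continuous)
  have hsub : Icc t₀ (t₀ + 1) ∩ γ ⁻¹' K ⊆ Ico t₀ (t₀ + 1) := by
    rintro t ⟨ht, htK⟩
    refine ⟨ht.1, ht.2.lt_of_ne ?_⟩
    rintro rfl
    exact ht₀ (by simpa [hγ.add_one] using htK)
  have := hasLogOn_image hKt hγ.continuous.continuousOn hF.continuousOn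
    (fun s hs t ht h ↦ by rw [hγ.injOn_Ico t₀ (hsub hs) (hsub ht) h]) fun t _ ↦ hFg t
  rwa [image_inter_preimage, hγ.image_Icc, inter_eq_right.2 hKγ] at this

/-- Any two nonvanishing functions on a Jordan curve are multiplicatively dependent modulo
exponentials. -/
lemma exists_hasLogOn_zpow_mul_zpow {γ : ℝ → ℂ} (hγ : IsJordan γ)
    {g h : ℂ → ℂ} (hg : ContinuousOn g (range γ))
    (hg0 : ∀ z ∈ range γ, g z ≠ 0) (hh : ContinuousOn h (range γ))
    (hh0 : ∀ z ∈ range γ, h z ≠ 0) :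
    ∃ m n : ℤ, (m ≠ 0 ∨ n ≠ 0) ∧ HasLogOn (fun z ↦ g z ^ m * h z ^ n) (range γ) := by
  obtain ⟨F, hF, hFg⟩ := hγ.exists_log hg hg0
  obtain ⟨G, hG, hGh⟩ := hγ.exists_log hh hh0
  have key : ∀ {f : ℂ → ℂ} {L : ℝ → ℂ}, (∀ t, exp (L t) = f (γ t)) →
      ∃ k : ℤ, L 1 = L 0 + k * (2 * Real.pi * I) := fun {f L} h ↦ by
    rw [← exp_eq_exp_iff_exists_int, h, h, ← zero_add (1 : ℝ), hγ.add_one]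
  obtain ⟨a, ha⟩ := key hFg
  obtain ⟨b, hb⟩ := key hGh
  have main : ∀ m n : ℤ, m * a + n * b = 0 →
      HasLogOn (fun z ↦ g z ^ m * h z ^ n) (range γ) := fun m n hmn ↦ by
    have hmn' : (m * a + n * b : ℂ) = 0 := by exact_mod_cast hmn
    have h01 : (m * F 1 + n * G 1 : ℂ) = m * F 0 + n * G 0 := by
      rw [ha, hb]
      linear_combination (2 * Real.pi * I) * hmn'
    rw [← hγ.image_Icc 0]
    refine hasLogOn_image isCompact_Icc hγ.continuous.continuousOn
      (F := fun t ↦ m * F t + n * G t) (by fun_prop) ?_ fun t _ ↦ ?_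
    · intro s hs t ht hst
      rw [zero_add] at hs ht
      rcases hs.2.eq_or_lt with rfl | hs1 <;> rcases ht.2.eq_or_lt with rfl | ht1
      · rfl
      · have : t = 0 := (hγ.injOn_Ico 0 ⟨le_rfl, by simp⟩ ⟨ht.1, by simpa using ht1⟩
          (by rw [← hst, ← hγ.add_one 0, zero_add])).symm
        rw [this, h01]
      · have : s = 0 := (hγ.injOn_Ico 0 ⟨le_rfl, by simp⟩ ⟨hs.1, by simpa using hs1⟩
          (by rw [hst, ← hγ.add_one 0, zero_add])).symm
        rw [this, h01]
      · rw [hγ.injOn_Ico 0 ⟨hs.1, by simpa using hs1⟩ ⟨ht.1, by simpa using ht1⟩ hst]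
    · rw [exp_add, exp_int_mul, exp_int_mul, hFg, hGh]
  by_cases ha0 : a = 0
  · exact ⟨1, 0, by simp, main _ _ (by simp [ha0])⟩
  · exact ⟨b, -a, by simp [ha0], main _ _ (by ring)⟩

end IsJordan

section Interior

open Complex Bornology unitInterval

/-- The endpoints of a path are not separated, from the point of view of logarithms, outside of
the path. -/
lemma hasLogOn_div_of_path {c : I → ℂ} (hc : Continuous c) {S : Set ℂ}
    (hS : ∀ z ∈ S, ∀ t, z ≠ c t) : HasLogOn (fun z ↦ (z - c 0) / (z - c 1)) S := by
  classical
  have hne : ∀ (z : S) t, (z : ℂ) - c t ≠ 0 := fun z t ↦ sub_ne_zero.2 (hS z z.2 t)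
  let H : C(I × S, {z : ℂ // z ≠ 0}) :=
    ⟨fun x ↦ ⟨(x.2 - c 0) / (x.2 - c x.1), div_ne_zero (hne _ _) (hne _ _)⟩,
      Continuous.subtype_mk (Continuous.div (by fun_prop) (by fun_prop) fun x ↦ hne _ _) _⟩
  have h0 : ∀ z : S, H (0, z) = ⟨exp ((ContinuousMap.const S (0 : ℂ)) z), exp_ne_zero _⟩ :=
    fun z ↦ by simp [H, div_self (hne z 0)]
  let L := isCoveringMap_exp.liftHomotopy H (.const S 0) h0
  have hL : ∀ z : S, exp (L (1, z)) = (z - c 0) / (z - c 1) := fun z ↦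
    congrArg Subtype.val (congrFun (isCoveringMap_exp.liftHomotopy_lifts H (.const S 0) h0) (1, z))
  refine ⟨fun z ↦ if h : z ∈ S then L (1, ⟨z, h⟩) else 0, ?_, fun z hz ↦ ?_⟩
  · rw [continuousOn_iff_continuous_domRestrict]
    have : Continuous fun z : S ↦ L (1, z) := by fun_prop
    convert! this using 1
    ext z
    simp
  · simpa only [dif_pos hz] using hL ⟨z, hz⟩

namespace IsJordan

lemma not_isPreconnected_compl_range {γ : ℝ → ℂ} (hγ : IsJordan γ)
    : ¬ IsPreconnected (range γ)ᶜ := by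
  intro hpre
  set A := γ '' Icc 0 (1 / 2)
  set B := γ '' Icc (1 / 2) 1
  have hAB : A ∪ B = range γ := by
    rw [← image_union, Icc_union_Icc_eq_Icc (by norm_num) (by norm_num), ← hγ.image_Icc 0, zero_add]
  have h1 : γ 1 = γ 0 := by simpa using hγ.add_one 0
  have hab : γ 0 ≠ γ (1 / 2) := fun h ↦ by
    have := hγ.injOn_Ico 0 (by simp) (by norm_num) h
    norm_num at this
  have hinter : A ∩ B ⊆ {γ 0, γ (1 / 2)} := by
    rintro _ ⟨⟨s, hs, rfl⟩, t, ht, hst⟩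
    rcases ht.2.eq_or_lt with rfl | ht1
    · simp [← hst, h1]
    · have : t = s := hγ.injOn_Ico 0 ⟨by linarith [ht.1], by simpa using ht1⟩
        ⟨hs.1, by linarith [hs.2]⟩ hst
      have : s = 1 / 2 := le_antisymm hs.2 (this ▸ ht.1)
      simp [this]
  have hA : HasLogOn (fun z ↦ (z - γ 0) / (z - γ (1 / 2))) Aᶜ := by
    have := hasLogOn_div_of_path (c := fun t : I ↦ γ (t / 2)) (S := Aᶜ)
      (hγ.continuous.comp (by fun_prop)) ?_
    · simpa using this
    · rintro z hz t rfl
      exact hz ⟨_, ⟨by linarith [t.2.1], by linarith [t.2.2]⟩, rfl⟩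
  have hB : HasLogOn (fun z ↦ (z - γ 0) / (z - γ (1 / 2))) Bᶜ := by
    have := hasLogOn_div_of_path (c := fun t : I ↦ γ (1 - t / 2)) (S := Bᶜ)
      (hγ.continuous.comp (by fun_prop)) ?_
    · have h2 : (1 - 2⁻¹ : ℝ) = 2⁻¹ := by norm_num
      simpa [h1, h2] using this
    · rintro z hz t rfl
      exact hz ⟨_, ⟨by linarith [t.2.2], by linarith [t.2.1]⟩, rfl⟩
  have hAc : IsClosed A := (isCompact_Icc.image hγ.continuous).isClosed
  have hBc : IsClosed B := (isCompact_Icc.image hγ.continuous).isClosed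
  have hlog := hA.union (by rwa [← compl_union, hAB]) (Or.inr ⟨hAc.isOpen_compl, hBc.isOpen_compl⟩)
    hB
  rw [← compl_inter] at hlog
  set r := ‖γ 0 - γ (1 / 2)‖ / 2
  have hr : 0 < r := half_pos (norm_pos_iff.2 (sub_ne_zero.2 hab))
  have hr2 : ‖γ 0 - γ (1 / 2)‖ = 2 * r := by simp only [r]; ring
  have hsph : ∀ z ∈ sphere (γ 0) r, z ≠ γ 0 ∧ z ≠ γ (1 / 2) := by
    intro z hz
    rw [mem_sphere_iff_norm] at hz
    constructor
    · rintro rfl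
      rw [sub_self, norm_zero] at hz
      exact hr.ne hz
    · rintro rfl
      rw [norm_sub_rev, hr2] at hz
      linarith
  have hlog1 := hlog.mono (S := sphere (γ 0) r) fun z hz hzAB ↦ by
    have := hinter hzAB
    have := hsph z hz
    simp_all
  have hlog2 : HasLogOn (fun z ↦ (z - γ (1 / 2)) / (γ 0 - γ (1 / 2))) (sphere (γ 0) r) := by
    refine hasLogOn_of_norm_sub_one_lt (by fun_prop) fun z hz ↦ ?_
    rw [div_sub_one (sub_ne_zero.2 hab), norm_div, hr2, sub_sub_sub_cancel_right,
      mem_sphere_iff_norm.1 hz, div_lt_one (by positivity)]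
    linarith
  have hlog3 := (hlog1.mul hlog2).mul (hasLogOn_const (sub_ne_zero.2 hab))
  refine one_ne_zero (eq_zero_of_hasLogOn_sphere (p := γ 0) hr (n := 1) (hlog3.congr ?_))
  intro z hz
  have h3 : z - γ (1 / 2) ≠ 0 := sub_ne_zero.2 (hsph z hz).2
  have h4 := sub_ne_zero.2 hab
  simp only [zpow_one]
  field_simp

lemma frontier_component {γ : ℝ → ℂ} (hγ : IsJordan γ) {p : ℂ} (hp : p ∉ range γ)
    (hb : IsBounded (connectedComponentIn (range γ)ᶜ p)) :
    frontier (connectedComponentIn (range γ)ᶜ p) = range γ := by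
  have hfr := frontier_connectedComponentIn_compl_subset hγ.isCompact_range.isClosed p
  refine hfr.antisymm ?_
  rintro _ ⟨t, rfl⟩
  by_contra ht
  refine one_ne_zero (eq_zero_of_hasLogOn_frontier
    hγ.isCompact_range.isClosed.isOpen_compl.connectedComponentIn hb (mem_connectedComponentIn hp)
    (n := 1) (h := fun _ ↦ 1) continuousOn_const (by simp) ?_)
  simp only [zpow_one, mul_one]
  refine hγ.hasLogOn_of_notMem isClosed_frontier hfr ht (by fun_prop) fun z hz h ↦ hp ?_
  rwa [← sub_eq_zero.1 h]

lemma mem_component_of_isBounded {γ : ℝ → ℂ} (hγ : IsJordan γ)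
    {p q : ℂ} (hp : p ∉ range γ) (hq : q ∉ range γ)
    (hpb : IsBounded (connectedComponentIn (range γ)ᶜ p))
    (hqb : IsBounded (connectedComponentIn (range γ)ᶜ q)) :
    q ∈ connectedComponentIn (range γ)ᶜ p := by
  have hne : ∀ {a z : ℂ}, a ∉ range γ → z ∈ range γ → z - a ≠ 0 := fun {a z} ha hz h ↦
    ha (sub_eq_zero.1 h ▸ hz)
  have key : ∀ {a b : ℂ}, a ∉ range γ → b ∉ range γ →
      IsBounded (connectedComponentIn (range γ)ᶜ a) → b ∉ connectedComponentIn (range γ)ᶜ a →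
      ∀ {m n : ℤ}, HasLogOn (fun z ↦ (z - a) ^ m * (z - b) ^ n) (range γ) → m = 0 := by
    intro a b ha hb hab hmem m n hlog
    have hfr := frontier_connectedComponentIn_compl_subset hγ.isCompact_range.isClosed a
    have hne' : ∀ z ∈ closure (connectedComponentIn (range γ)ᶜ a), z - b ≠ 0 := by
      intro z hz h0
      rw [sub_eq_zero.1 h0, closure_eq_self_union_frontier] at hz
      exact hz.elim hmem fun h ↦ hb (hfr h)
    exact eq_zero_of_hasLogOn_frontier
      hγ.isCompact_range.isClosed.isOpen_compl.connectedComponentIn hab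
      (mem_connectedComponentIn ha)
      (ContinuousOn.zpow₀ (by fun_prop) n fun z hz ↦ Or.inl (hne' z hz))
      (fun z hz ↦ zpow_ne_zero _ (hne' z hz)) (hlog.mono hfr)
  by_contra hqp
  have hpq : p ∉ connectedComponentIn (range γ)ᶜ q := fun h ↦ hqp <| by
    rw [← connectedComponentIn_eq h]
    exact mem_connectedComponentIn hq
  obtain ⟨m, n, hmn, hlog⟩ := hγ.exists_hasLogOn_zpow_mul_zpow (g := fun z ↦ z - p)
    (h := fun z ↦ z - q) (by fun_prop) (fun z hz ↦ hne hp hz) (by fun_prop) fun z hz ↦ hne hq hz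
  rcases hmn with h | h
  · exact h (key hp hq hpb hqp hlog)
  · exact h (key hq hp hqb hpq (by simpa only [mul_comm] using hlog))

/-- The **Jordan curve theorem** in the plane. -/
theorem exists_interior {γ : ℝ → ℂ} (hγ : IsJordan γ)
    : ∃ U : Set ℂ, IsOpen U ∧ IsConnected U ∧ IsBounded U ∧
    frontier U = range γ ∧ IsPreconnected (closure U)ᶜ ∧ IsPreconnected Uᶜ := by
  have hopen := hγ.isCompact_range.isClosed.isOpen_compl
  obtain ⟨p, hp, hb⟩ : ∃ p, p ∉ range γ ∧ IsBounded (connectedComponentIn (range γ)ᶜ p) := by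
    by_contra! h
    refine hγ.not_isPreconnected_compl_range (isPreconnected_of_forall_pair fun p hp q hq ↦ ?_)
    exact ⟨_, connectedComponentIn_subset _ p, mem_connectedComponentIn hp,
      mem_connectedComponentIn_of_not_isBounded hγ.isCompact_range (h p hp) (h q hq),
      isPreconnected_connectedComponentIn⟩
  have hfr := hγ.frontier_component hp hb
  set U := connectedComponentIn (range γ)ᶜ p with hU
  have hUo : IsOpen U := hopen.connectedComponentIn
  have hcl : closure U = U ∪ range γ := by rw [closure_eq_self_union_frontier, hfr]
  have hWJ : (closure U)ᶜ ⊆ (range γ)ᶜ :=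
    compl_subset_compl.2 (hcl ▸ subset_union_right)
  have hnb : ∀ q ∈ (closure U)ᶜ, ¬ IsBounded (connectedComponentIn (range γ)ᶜ q) :=
    fun q hq h ↦ hq (subset_closure (hγ.mem_component_of_isBounded hp (hWJ hq) hb h))
  have hW : IsPreconnected (closure U)ᶜ := by
    refine isPreconnected_of_forall_pair fun q hq r hr ↦ ?_
    refine ⟨connectedComponentIn (range γ)ᶜ q, fun z hz hzU ↦ ?_, mem_connectedComponentIn (hWJ hq),
      mem_connectedComponentIn_of_not_isBounded hγ.isCompact_range (hnb q hq) (hnb r hr),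
      isPreconnected_connectedComponentIn⟩
    rw [hcl] at hzU
    rcases hzU with hzU | hzJ
    · apply hq
      apply subset_closure
      rw [hU, connectedComponentIn_eq hzU, ← connectedComponentIn_eq hz]
      exact mem_connectedComponentIn (hWJ hq)
    · exact connectedComponentIn_subset _ _ hz hzJ
  have hUne : p ∈ U := mem_connectedComponentIn hp
  refine ⟨U, hUo, ⟨⟨p, hUne⟩, isPreconnected_connectedComponentIn⟩, hb, hfr, hW, ?_⟩
  have hWU : closure (closure U)ᶜ ⊆ Uᶜ :=
    closure_minimal (compl_subset_compl.2 subset_closure) hUo.isClosed_compl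
  have hUc : Uᶜ = closure (closure U)ᶜ ∪ range γ := by
    refine Subset.antisymm (fun z hz ↦ ?_) (union_subset hWU ?_)
    · by_cases hzJ : z ∈ range γ
      · exact Or.inr hzJ
      · exact Or.inl (subset_closure (by rw [hcl]; simp [hzJ]; exact hz))
    · exact fun z hz hzU ↦ connectedComponentIn_subset _ _ hzU hz
  have hne : (closure (closure U)ᶜ ∩ range γ).Nonempty := by
    by_contra hemp
    have hclW : closure (closure U)ᶜ = (closure U)ᶜ := by
      refine Subset.antisymm (fun z hz ↦ ?_) subset_closure
      rw [hcl]
      rintro (h | h)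
      · exact hWU hz h
      · exact hemp ⟨z, hz, h⟩
    rcases isClopen_iff.1 ⟨isClosed_of_closure_subset hclW.subset,
      isClosed_closure.isOpen_compl⟩ with h | h
    · rw [compl_empty_iff] at h
      exact NormedSpace.unbounded_univ ℂ ℂ (h ▸ hb.closure)
    · have : p ∈ (closure U)ᶜ := h ▸ mem_univ p
      exact this (subset_closure hUne)
  obtain ⟨z, hz1, hz2⟩ := hne
  rw [hUc]
  exact hW.closure.union z hz1 hz2 hγ.isConnected_range.isPreconnected

end IsJordan

end Interior

section OpenLog

open Complex

lemma hasLogOn_of_forall_isCompact {U : Set ℂ} (hU : IsOpen U) (hUc : IsConnected U) {h : ℂ → ℂ}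
    (hK : ∀ K ⊆ U, IsCompact K → HasLogOn h K) : HasLogOn h U := by
  obtain ⟨z₀, hz₀⟩ := hUc.nonempty
  obtain ⟨c, hc⟩ : ∃ c, exp c = h z₀ :=
    let ⟨f, _, hf⟩ := hK {z₀} (by simpa) isCompact_singleton
    ⟨f z₀, hf z₀ rfl⟩
  have hnorm : ∀ K ⊆ U, IsCompact K → z₀ ∈ K →
      ∃ f : ℂ → ℂ, ContinuousOn f K ∧ (∀ x ∈ K, exp (f x) = h x) ∧ f z₀ = c := by
    intro K hKU hKc hzK
    obtain ⟨f, hf, hfe⟩ := hK K hKU hKc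
    refine ⟨fun x ↦ f x - f z₀ + c, by fun_prop, fun x hx ↦ ?_, by ring⟩
    rw [exp_add, exp_sub, hfe x hx, hfe z₀ hzK, hc]
    have : h z₀ ≠ 0 := hfe z₀ hzK ▸ exp_ne_zero _
    field_simp
  have hpath : ∀ z ∈ U, ∃ K ⊆ U, IsCompact K ∧ IsPreconnected K ∧ z₀ ∈ K ∧ z ∈ K := by
    intro z hz
    obtain ⟨p, hp⟩ := (hU.isConnected_iff_isPathConnected.1 hUc).joinedIn z₀ hz₀ z hz
    exact ⟨range p, range_subset_iff.2 hp, isCompact_range p.continuous,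
      isPreconnected_range p.continuous, ⟨0, p.source⟩, ⟨1, p.target⟩⟩
  have huniq : ∀ K ⊆ U, IsPreconnected K → z₀ ∈ K → ∀ f k : ℂ → ℂ, ContinuousOn f K →
      ContinuousOn k K → (∀ x ∈ K, exp (f x) = h x) → (∀ x ∈ K, exp (k x) = h x) →
      f z₀ = c → k z₀ = c → EqOn f k K := by
    intro K _ hKp hzK f k hf hk hfe hke hf0 hk0 x hx
    have := sub_eq_sub_of_exp_eq hKp hf hk (fun x hx ↦ (hfe x hx).trans (hke x hx).symm) hx hzK
    rw [hf0, hk0] at this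
    linear_combination this
  choose! K hKU hKc hKp hK0 hKz using hpath
  choose! f hf hfe hf0 using hnorm
  have hL : ∀ T ⊆ U, IsCompact T → IsPreconnected T → z₀ ∈ T → ∀ z ∈ T,
      f (K z) z = f T z := by
    intro T hTU hTc hTp hT0 z hz
    have hzU := hTU hz
    have hun : K z ∪ T ⊆ U := union_subset (hKU z hzU) hTU
    have hunc := (hKc z hzU).union hTc
    have h0 : z₀ ∈ K z ∪ T := Or.inr hT0
    have e1 := huniq _ (hKU z hzU) (hKp z hzU) (hK0 z hzU) _ (f (K z ∪ T))
      (hf _ (hKU z hzU) (hKc z hzU) (hK0 z hzU)) ((hf _ hun hunc h0).mono subset_union_left)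
      (hfe _ (hKU z hzU) (hKc z hzU) (hK0 z hzU)) (fun x hx ↦ hfe _ hun hunc h0 x (Or.inl hx))
      (hf0 _ (hKU z hzU) (hKc z hzU) (hK0 z hzU)) (hf0 _ hun hunc h0) (hKz z hzU)
    have e2 := huniq _ hTU hTp hT0 _ (f (K z ∪ T))
      (hf _ hTU hTc hT0) ((hf _ hun hunc h0).mono subset_union_right)
      (hfe _ hTU hTc hT0) (fun x hx ↦ hfe _ hun hunc h0 x (Or.inr hx))
      (hf0 _ hTU hTc hT0) (hf0 _ hun hunc h0) hz
    rw [e1, e2]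
  refine ⟨fun z ↦ f (K z) z, fun z hz ↦ ?_, fun z hz ↦
    hfe _ (hKU z hz) (hKc z hz) (hK0 z hz) z (hKz z hz)⟩
  obtain ⟨ε, hε, hεU⟩ := Metric.nhds_basis_closedBall.mem_iff.1 (hU.mem_nhds hz)
  set T := K z ∪ closedBall z ε
  have hTU : T ⊆ U := union_subset (hKU z hz) hεU
  have hTc : IsCompact T := (hKc z hz).union (isCompact_closedBall z ε)
  have hTp : IsPreconnected T := (hKp z hz).union z (hKz z hz) (mem_closedBall_self hε.le)
    (convex_closedBall z ε).isPreconnected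
  have hT0 : z₀ ∈ T := Or.inl (hK0 z hz)
  have hTn : T ∈ nhds z := Filter.mem_of_superset (closedBall_mem_nhds z hε) subset_union_right
  refine ContinuousAt.continuousWithinAt ?_
  refine ((hf T hTU hTc hT0).continuousAt hTn).congr ?_
  filter_upwards [hTn] with w hw using (hL T hTU hTc hTp hT0 w hw).symm

end OpenLog

section Moebius

open Complex ComplexConjugate

/-- The Möbius automorphism of the unit disc sending `a` to `0`. -/
noncomputable def moebius (a z : ℂ) : ℂ := (z - a) / (1 - conj a * z)

variable {a z : ℂ}

lemma moebius_denom_ne_zero (ha : ‖a‖ < 1) (hz : ‖z‖ ≤ 1) : 1 - conj a * z ≠ 0 := by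
  intro h
  have h1 : ‖conj a * z‖ = 1 := by rw [← sub_eq_zero.1 h, norm_one]
  rw [norm_mul, RCLike.norm_conj] at h1
  nlinarith [norm_nonneg a, norm_nonneg z]

lemma one_sub_normSq_moebius (ha : ‖a‖ < 1) (hz : ‖z‖ ≤ 1) :
    1 - normSq (moebius a z) = (1 - normSq a) * (1 - normSq z) / normSq (1 - conj a * z) := by
  have h : normSq (1 - conj a * z) ≠ 0 := by
    simpa [normSq_eq_zero] using moebius_denom_ne_zero ha hz
  rw [moebius, normSq_div, eq_div_iff h, sub_mul, div_mul_cancel₀ _ h]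
  simp only [normSq_apply, sub_re, sub_im, one_re, one_im, mul_re, mul_im, conj_re, conj_im]
  ring

lemma norm_moebius_le_one (ha : ‖a‖ < 1) (hz : ‖z‖ ≤ 1) : ‖moebius a z‖ ≤ 1 := by
  have h := one_sub_normSq_moebius ha hz
  have : 0 ≤ (1 - normSq a) * (1 - normSq z) / normSq (1 - conj a * z) := by
    refine div_nonneg (mul_nonneg ?_ ?_) (normSq_nonneg _) <;> rw [normSq_eq_norm_sq] <;>
      nlinarith [norm_nonneg a, norm_nonneg z]
  rw [← h, normSq_eq_norm_sq] at this
  nlinarith [norm_nonneg (moebius a z)]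

lemma norm_moebius_lt_one (ha : ‖a‖ < 1) (hz : ‖z‖ < 1) : ‖moebius a z‖ < 1 := by
  have h := one_sub_normSq_moebius ha hz.le
  have : 0 < (1 - normSq a) * (1 - normSq z) / normSq (1 - conj a * z) := by
    refine div_pos (mul_pos ?_ ?_) (normSq_pos.2 (moebius_denom_ne_zero ha hz.le)) <;>
      rw [normSq_eq_norm_sq] <;> nlinarith [norm_nonneg a, norm_nonneg z]
  rw [← h, normSq_eq_norm_sq] at this
  nlinarith [norm_nonneg (moebius a z)]

lemma moebius_neg_moebius (ha : ‖a‖ < 1) (hz : ‖z‖ ≤ 1) : moebius (-a) (moebius a z) = z := by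
  have h1 := moebius_denom_ne_zero ha hz
  have h2 : 1 - conj a * a ≠ 0 := moebius_denom_ne_zero ha ha.le
  have h3 : 1 + conj a * moebius a z ≠ 0 := by
    simpa using moebius_denom_ne_zero (a := -a) (by simpa) (norm_moebius_le_one ha hz)
  rw [moebius, map_neg, neg_mul, sub_neg_eq_add, sub_neg_eq_add, div_eq_iff h3, moebius]
  generalize hd : 1 - conj a * z = d at *
  field_simp
  rw [← hd]
  ring

lemma injOn_moebius (ha : ‖a‖ < 1) : InjOn (moebius a) (closedBall 0 1) := fun x hx y hy h ↦ by
  rw [← moebius_neg_moebius ha (mem_closedBall_zero_iff.1 hx), h,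
    moebius_neg_moebius ha (mem_closedBall_zero_iff.1 hy)]

lemma image_moebius_closedBall (ha : ‖a‖ < 1) :
    moebius a '' closedBall 0 1 = closedBall 0 1 := by
  refine Subset.antisymm ?_ fun z hz ↦ ⟨moebius (-a) z, ?_, ?_⟩
  · rintro _ ⟨z, hz, rfl⟩
    exact mem_closedBall_zero_iff.2 (norm_moebius_le_one ha (mem_closedBall_zero_iff.1 hz))
  · exact mem_closedBall_zero_iff.2
      (norm_moebius_le_one (by simpa) (mem_closedBall_zero_iff.1 hz))
  · simpa using moebius_neg_moebius (a := -a) (by simpa) (mem_closedBall_zero_iff.1 hz)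

lemma hasDerivAt_moebius (ha : ‖a‖ < 1) (hz : ‖z‖ ≤ 1) :
    HasDerivAt (moebius a) ((1 - conj a * a) / (1 - conj a * z) ^ 2) z := by
  have h := moebius_denom_ne_zero ha hz
  have := ((hasDerivAt_id z).sub_const a).div
    (((hasDerivAt_id z).const_mul (conj a)).const_sub 1) h
  refine this.congr_deriv ?_
  simp only [id]
  congr 1
  ring

lemma continuousOn_moebius (ha : ‖a‖ < 1) : ContinuousOn (moebius a) (closedBall 0 1) :=
  fun _ hz ↦ (hasDerivAt_moebius ha (mem_closedBall_zero_iff.1 hz)).continuousAt.continuousWithinAt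

@[simp] lemma moebius_self : moebius a a = 0 := by simp [moebius]

@[simp] lemma moebius_zero : moebius a 0 = -a := by simp [moebius]

end Moebius

section Koebe

open Complex ComplexConjugate

/-- Univalent maps of `U` into the unit disc sending `z₀` to `0` and whose image has connected
complement. -/
structure IsAdmissible (U : Set ℂ) (z₀ : ℂ) (f : ℂ → ℂ) : Prop where
  diff : DifferentiableOn ℂ f U
  inv : ∃ g, DifferentiableOn ℂ g (f '' U) ∧ LeftInvOn g f U
  maps : MapsTo f U (ball 0 1)
  zero : f z₀ = 0
  conn : IsPreconnected (closedBall 0 1 \ f '' U)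

lemma IsAdmissible.inj {U : Set ℂ} {z₀ : ℂ} {f : ℂ → ℂ} (hf : IsAdmissible U z₀ f) :
    InjOn f U :=
  let ⟨_, _, h⟩ := hf.inv
  h.injOn

lemma isOpen_image_of_injOn {U : Set ℂ} {f : ℂ → ℂ} (hU : IsOpen U)
    (hUc : IsPreconnected U) (hf : DifferentiableOn ℂ f U) (hi : InjOn f U) :
    IsOpen (f '' U) := by
  rcases (hf.analyticOnNhd hU).is_constant_or_isOpen hUc with ⟨w, hw⟩ | h
  · rcases U.eq_empty_or_nonempty with rfl | ⟨z, hz⟩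
    · simp
    · have : U ⊆ {z} := fun x hx ↦ hi hx hz ((hw x hx).trans (hw z hz).symm)
      have hUz : U = {z} := this.antisymm (by simpa)
      exact absurd (hUz ▸ hU) (not_isOpen_singleton z)
  · exact h U Subset.rfl hU

lemma isPreconnected_closedBall_diff_moebius {a : ℂ} (ha : ‖a‖ < 1) {V : Set ℂ}
    (hV : V ⊆ ball 0 1) (hc : IsPreconnected (closedBall 0 1 \ V)) :
    IsPreconnected (closedBall 0 1 \ moebius a '' V) := by
  have h := hc.image (moebius a) ((continuousOn_moebius ha).mono sdiff_subset)
  rwa [(injOn_moebius ha).image_sdiff_subset (hV.trans ball_subset_closedBall),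
    image_moebius_closedBall ha] at h

/-- Holomorphic square root on a subdomain of the disc omitting `0` with connected complement. -/
lemma exists_sqrt {V : Set ℂ} (hV : IsOpen V) (hVc : IsConnected V)
    (hV1 : V ⊆ ball 0 1) (h0 : (0 : ℂ) ∉ V) (hc : IsPreconnected (closedBall 0 1 \ V)) :
    ∃ s : ℂ → ℂ, DifferentiableOn ℂ s V ∧ ∀ z ∈ V, s z ^ 2 = z := by
  obtain ⟨L, hL, hLe⟩ : HasLogOn (fun z ↦ z) V := by
    refine hasLogOn_of_forall_isCompact hV hVc fun K hKV hK ↦ ?_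
    have h1 := hasLogOn_div_of_isPreconnected hK hc (fun z hz hzK ↦ hz.2 (hKV hzK))
      (p := 0) (q := 1) ⟨by simp, h0⟩ ⟨by simp, fun h ↦ by simpa using hV1 h⟩
    have h2 : HasLogOn (fun z ↦ (-1) * (1 - z)) K := by
      refine (hasLogOn_const (by simp)).mul (hasLogOn_of_norm_sub_one_lt (by fun_prop) ?_)
      intro z hz
      simpa using hV1 (hKV hz)
    refine (h1.mul h2).congr fun z hz ↦ ?_
    have : z - 1 ≠ 0 := fun h ↦ by
      have := hV1 (hKV hz)
      rw [sub_eq_zero.1 h] at this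
      simp at this
    simp only
    field_simp
    ring
  have hs : ∀ z ∈ V, exp (L z / 2) ^ 2 = z := fun z hz ↦ by
    rw [← exp_nat_mul]
    refine Eq.trans (congrArg exp ?_) (hLe z hz)
    push_cast
    ring
  refine ⟨fun z ↦ exp (L z / 2), fun z hz ↦ ?_, hs⟩
  refine DifferentiableAt.differentiableWithinAt ?_
  refine (HasDerivAt.of_local_left_inverse (f := fun z ↦ z ^ 2)
    (f' := 2 * exp (L z / 2)) ?_ ?_ (by simp) ?_).differentiableAt
  · exact ((hL.continuousAt (hV.mem_nhds hz)).div_const 2).cexp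
  · simpa using hasDerivAt_pow 2 (exp (L z / 2))
  · filter_upwards [hV.mem_nhds hz] with w hw using hs w hw

lemma isPreconnected_closedBall_diff_sqrt {V : Set ℂ} (hV : IsOpen V) (hVc : IsConnected V)
    (hV1 : V ⊆ ball 0 1) (h0 : (0 : ℂ) ∉ V) (hc : IsPreconnected (closedBall 0 1 \ V))
    {s : ℂ → ℂ} (hs : DifferentiableOn ℂ s V) (hs2 : ∀ z ∈ V, s z ^ 2 = z) :
    IsPreconnected (closedBall 0 1 \ s '' V) := by
  set T : Set ℂ := {w | ‖w‖ ≤ 1 ∧ w ^ 2 ∉ V} with hT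
  have hsi : InjOn s V := fun x hx y hy h ↦ by rw [← hs2 x hx, h, hs2 y hy]
  have hne : ∀ z ∈ V, s z ≠ 0 := fun z hz h ↦ h0 (by
    have := hs2 z hz
    rw [h, zero_pow two_ne_zero] at this
    rwa [this])
  have hopen : IsOpen (s '' V) := isOpen_image_of_injOn hV hVc.isPreconnected hs hsi
  have hTclosed : IsClosed T :=
    (isClosed_le continuous_norm continuous_const).inter
      (hV.isClosed_compl.preimage (continuous_pow 2))
  have hTc : IsCompact T := (isCompact_closedBall (0 : ℂ) 1).of_isClosed_subset hTclosed
    fun w hw ↦ mem_closedBall_zero_iff.2 hw.1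
  have h0T : (0 : ℂ) ∈ T := by simp [hT, h0]
  have hTneg : ∀ w ∈ T, -w ∈ T := fun w hw ↦ by simpa [hT] using hw
  have hTp : IsPreconnected T := by
    have key : ∀ A B : Set ℂ, IsClosed A → IsClosed B → T ⊆ A ∪ B → (0 : ℂ) ∈ A →
        (T ∩ B).Nonempty → (T ∩ (A ∩ B)).Nonempty := by
      intro A B hA hB hAB h0A hTB
      have hA' : IsClosed ((fun w : ℂ ↦ w ^ 2) '' (T ∩ (A ∩ -A))) :=
        ((hTc.inter_right (hA.inter hA.neg)).image (continuous_pow 2)).isClosed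
      have hB' : IsClosed ((fun w : ℂ ↦ w ^ 2) '' (T ∩ B)) :=
        ((hTc.inter_right hB).image (continuous_pow 2)).isClosed
      have hmem : ∀ w ∈ T, w ^ 2 ∈ closedBall (0 : ℂ) 1 \ V := fun w hw ↦
        ⟨by simpa using hw.1, hw.2⟩
      obtain ⟨c, -, ⟨w, ⟨hwT, hwA, hwA'⟩, rfl⟩, v, ⟨hvT, hvB⟩, hvw⟩ :=
        isPreconnected_closed_iff.1 hc _ _ hA' hB' (by
          rintro c ⟨hc1, hcV⟩
          obtain ⟨w, rfl⟩ : ∃ w : ℂ, w ^ 2 = c := IsAlgClosed.exists_pow_nat_eq c two_pos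
          have hwT : w ∈ T := by
            refine ⟨?_, hcV⟩
            rw [mem_closedBall_zero_iff, norm_pow] at hc1
            nlinarith [norm_nonneg w]
          by_cases hwB : w ∈ B
          · exact Or.inr ⟨w, ⟨hwT, hwB⟩, rfl⟩
          by_cases hwB' : -w ∈ B
          · exact Or.inr ⟨-w, ⟨hTneg w hwT, hwB'⟩, by simp⟩
          exact Or.inl ⟨w, ⟨hwT, (hAB hwT).resolve_right hwB,
            (hAB (hTneg w hwT)).resolve_right hwB'⟩, rfl⟩)
          ⟨0, by simp [h0], 0, ⟨h0T, h0A, by simpa⟩, by simp⟩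
          (by
            obtain ⟨w, hw⟩ := hTB
            exact ⟨w ^ 2, hmem w hw.1, w, hw, rfl⟩)
      refine ⟨v, hvT, ?_, hvB⟩
      rcases sq_eq_sq_iff_eq_or_eq_neg.1 hvw with rfl | rfl
      · exact hwA
      · exact hwA'
    refine isPreconnected_closed_iff.2 fun A B hA hB hAB hTA hTB ↦ ?_
    rcases hAB h0T with h | h
    · exact key A B hA hB hAB h hTB
    · rw [inter_comm A B]
      exact key B A hB hA (by rwa [union_comm]) h hTA
  set W : Set ℂ := (fun z ↦ -s z) '' V with hW
  have hWeq : ∀ w, -w ∈ W ↔ w ∈ s '' V := fun w ↦ by simp [hW]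
  have hWopen : IsOpen W := by
    have : W = -(s '' V) := by ext w; rw [Set.mem_neg, ← hWeq, neg_neg]
    rw [this]
    exact hopen.neg
  have hWdisj : Disjoint (s '' V) W := by
    rw [Set.disjoint_left]
    rintro _ ⟨x, hx, rfl⟩ ⟨y, hy, hxy⟩
    have hxy' : x = y := by rw [← hs2 x hx, ← hs2 y hy, ← hxy]; ring
    subst hxy'
    refine hne x hx ?_
    linear_combination (-1 / 2 : ℂ) * hxy
  have hWp : IsPreconnected W := hVc.isPreconnected.image _ hs.continuousOn.neg
  have hnorm : ∀ z ∈ V, ‖s z‖ ≤ 1 := by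
    intro z hz
    have h1 : ‖s z ^ 2‖ < 1 := by simpa [hs2 z hz] using hV1 hz
    rw [norm_pow] at h1
    nlinarith [norm_nonneg (s z)]
  have hcover : ∀ w : ℂ, ‖w‖ ≤ 1 → w ∈ T ∨ w ∈ s '' V ∨ w ∈ W := by
    intro w hw
    by_cases h : w ^ 2 ∈ V
    · right
      rcases sq_eq_sq_iff_eq_or_eq_neg.1 (hs2 _ h) with h' | h'
      · exact Or.inl ⟨_, h, h'⟩
      · exact Or.inr ⟨_, h, by simp [h']⟩
    · exact Or.inl ⟨hw, h⟩
  have hWball : W ⊆ closedBall 0 1 := by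
    rintro _ ⟨z, hz, rfl⟩
    simpa using hnorm z hz
  have heq : closedBall 0 1 \ s '' V = T ∪ W := by
    ext w
    constructor
    · rintro ⟨hw, hws⟩
      have := hcover w (mem_closedBall_zero_iff.1 hw)
      tauto
    · rintro (hw | hw)
      · refine ⟨mem_closedBall_zero_iff.2 hw.1, ?_⟩
        rintro ⟨z, hz, rfl⟩
        exact hw.2 (by rwa [hs2 z hz])
      · exact ⟨hWball hw, fun h ↦ Set.disjoint_left.1 hWdisj h hw⟩
  obtain ⟨t, htW, htW'⟩ : ∃ t ∈ closure W, t ∉ W := by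
    by_contra! h
    have hcl : IsClosed W := isClosed_of_closure_subset h
    have hWuniv : W = univ := IsClopen.eq_univ ⟨hcl, hWopen⟩ (hVc.nonempty.image _)
    have : (2 : ℂ) ∈ W := hWuniv ▸ mem_univ _
    have := hWball this
    norm_num at this
  have htT : t ∈ T := by
    have htb : ‖t‖ ≤ 1 :=
      mem_closedBall_zero_iff.1 (closure_minimal hWball isClosed_closedBall htW)
    rcases hcover t htb with h | h | h
    · exact h
    · exact absurd htW ((hopen.mem_nhds h |> fun hn hcl ↦ by
        obtain ⟨y, hy1, hy2⟩ := mem_closure_iff_nhds.1 hcl _ hn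
        exact Set.disjoint_left.1 hWdisj hy1 hy2))
    · exact absurd h htW'
  have hWt : IsPreconnected (insert t W) :=
    hWp.subset_closure (subset_insert _ _) (insert_subset htW subset_closure)
  have := hTp.union t htT (mem_insert t W) hWt
  rwa [union_insert, insert_eq_of_mem (mem_union_left _ htT), ← heq] at this

/-- The Koebe square root step. -/
lemma IsAdmissible.exists_koebe {U : Set ℂ} (hU : IsOpen U) (hUc : IsConnected U) {z₀ : ℂ}
    (hz₀ : z₀ ∈ U) {f : ℂ → ℂ} (hf : IsAdmissible U z₀ f) {a : ℂ} (ha : ‖a‖ < 1)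
    (haf : a ∉ f '' U) :
    ∃ h, IsAdmissible U z₀ h ∧
      ‖deriv h z₀‖ = (1 + ‖a‖) / (2 * √‖a‖) * ‖deriv f z₀‖ := by
  have hfopen := isOpen_image_of_injOn hU hUc.isPreconnected hf.diff hf.inj
  have hfb : f '' U ⊆ ball 0 1 := hf.maps.image_subset
  have hmlt : ∀ z ∈ ball (0 : ℂ) 1, moebius a z ∈ ball (0 : ℂ) 1 := fun z hz ↦
    mem_ball_zero_iff.2 (norm_moebius_lt_one ha (mem_ball_zero_iff.1 hz))
  have hmd : ∀ {c : ℂ}, ‖c‖ < 1 → DifferentiableOn ℂ (moebius c) (ball 0 1) := fun hc z hz ↦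
    (hasDerivAt_moebius hc (mem_ball_zero_iff.1 hz).le).differentiableAt.differentiableWithinAt
  have hmi : InjOn (moebius a) (f '' U) :=
    (injOn_moebius ha).mono (hfb.trans ball_subset_closedBall)
  set V := moebius a '' (f '' U) with hV
  have hfconn : IsConnected (f '' U) := hUc.image _ hf.diff.continuousOn
  have hVopen : IsOpen V :=
    isOpen_image_of_injOn hfopen hfconn.isPreconnected ((hmd ha).mono hfb) hmi
  have hVc : IsConnected V := hfconn.image _ ((hmd ha).mono hfb).continuousOn
  have hVb : V ⊆ ball 0 1 := by
    rintro _ ⟨z, hz, rfl⟩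
    exact hmlt z (hfb hz)
  have h0V : (0 : ℂ) ∉ V := by
    rintro ⟨z, hz, hz0⟩
    rw [← moebius_self (a := a)] at hz0
    have := injOn_moebius ha (ball_subset_closedBall (hfb hz))
      (mem_closedBall_zero_iff.2 ha.le) hz0
    exact haf (this ▸ hz)
  have hVconn := isPreconnected_closedBall_diff_moebius ha hfb hf.conn
  obtain ⟨s, hs, hs2⟩ := exists_sqrt hVopen hVc hVb h0V hVconn
  have hsconn := isPreconnected_closedBall_diff_sqrt hVopen hVc hVb h0V hVconn hs hs2
  have hsb : ∀ z ∈ V, ‖s z‖ < 1 := by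
    intro z hz
    have h1 : ‖s z ^ 2‖ < 1 := by simpa [hs2 z hz] using hVb hz
    rw [norm_pow] at h1
    nlinarith [norm_nonneg (s z)]
  have hsB : s '' V ⊆ ball 0 1 := by
    rintro _ ⟨z, hz, rfl⟩
    exact mem_ball_zero_iff.2 (hsb z hz)
  have hmaps : MapsTo (fun z ↦ moebius a (f z)) U V := fun z hz ↦ ⟨f z, ⟨z, hz, rfl⟩, rfl⟩
  have haV : -a ∈ V := ⟨0, ⟨z₀, hz₀, hf.zero⟩, moebius_zero⟩
  set b := s (-a) with hb
  have hb1 : ‖b‖ < 1 := hsb _ haV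
  have hb2 : ‖b‖ ^ 2 = ‖a‖ := by rw [← norm_pow, hb, hs2 _ haV, norm_neg]
  have ha0 : a ≠ 0 := fun h ↦ haf ⟨z₀, hz₀, by rw [hf.zero, h]⟩
  have hdiff1 : DifferentiableOn ℂ (fun z ↦ moebius a (f z)) U :=
    (hmd ha).comp hf.diff hf.maps
  have hdiff2 : DifferentiableOn ℂ (fun z ↦ s (moebius a (f z))) U := hs.comp hdiff1 hmaps
  refine ⟨fun z ↦ moebius b (s (moebius a (f z))), ⟨?_, ?_, ?_, ?_, ?_⟩, ?_⟩
  · exact (hmd hb1).comp hdiff2 fun z hz ↦ hsB ⟨_, hmaps hz, rfl⟩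
  · obtain ⟨g, hg, hgf⟩ := hf.inv
    have e1 : ∀ z ∈ U, moebius (-b) (moebius b (s (moebius a (f z)))) ^ 2 =
        moebius a (f z) := fun z hz ↦ by
      rw [moebius_neg_moebius hb1 (hsb _ (hmaps hz)).le, hs2 _ (hmaps hz)]
    have e2 : ∀ z ∈ U, moebius (-a) (moebius (-b) (moebius b (s (moebius a (f z)))) ^ 2) =
        f z := fun z hz ↦ by
      rw [e1 z hz, moebius_neg_moebius ha (mem_ball_zero_iff.1 (hf.maps hz)).le]
    refine ⟨fun w ↦ g (moebius (-a) (moebius (-b) w ^ 2)), ?_, fun z hz ↦ ?_⟩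
    · refine hg.comp ((hmd (c := -a) (by simpa)).comp
        (((hmd (c := -b) (by simpa)).mono ?_).pow 2) ?_) ?_
      · rintro _ ⟨z, hz, rfl⟩
        exact mem_ball_zero_iff.2 (norm_moebius_lt_one hb1 (hsb _ (hmaps hz)))
      · rintro _ ⟨z, hz, rfl⟩
        beta_reduce
        rw [e1 z hz]
        exact hVb (hmaps hz)
      · rintro _ ⟨z, hz, rfl⟩
        beta_reduce
        rw [e2 z hz]
        exact mem_image_of_mem f hz
    · simp only [e2 z hz]
      exact hgf hz
  · exact fun z hz ↦ mem_ball_zero_iff.2 (norm_moebius_lt_one hb1 (hsb _ (hmaps hz)))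
  · simp [hf.zero, ← hb]
  · have := isPreconnected_closedBall_diff_moebius hb1 hsB hsconn
    rwa [hV, image_image, image_image, image_image] at this
  · have d1 : HasDerivAt f (deriv f z₀) z₀ :=
      (hf.diff.differentiableAt (hU.mem_nhds hz₀)).hasDerivAt
    have d2 : HasDerivAt (moebius a) (1 - conj a * a) (f z₀) := by
      simpa [hf.zero] using hasDerivAt_moebius ha (z := 0) (by simp)
    have d3 : HasDerivAt s (deriv s (-a)) (moebius a (f z₀)) := by
      rw [hf.zero, moebius_zero]
      exact (hs.differentiableAt (hVopen.mem_nhds haV)).hasDerivAt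
    have d4 : HasDerivAt (moebius b) ((1 - conj b * b) / (1 - conj b * b) ^ 2)
        (s (moebius a (f z₀))) := by
      rw [hf.zero, moebius_zero, ← hb]
      exact hasDerivAt_moebius hb1 hb1.le
    have hs' : 2 * b * deriv s (-a) = 1 := by
      have e1 : HasDerivAt (fun z ↦ s z ^ 2) (2 * b * deriv s (-a)) (-a) := by
        simpa using (hs.differentiableAt (hVopen.mem_nhds haV)).hasDerivAt.fun_pow 2
      have e2 : HasDerivAt (fun z ↦ s z ^ 2) 1 (-a) := by
        refine (hasDerivAt_id (-a)).congr_of_eventuallyEq ?_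
        filter_upwards [hVopen.mem_nhds haV] with z hz using hs2 z hz
      exact e1.unique e2
    have key := (d4.comp z₀ (d3.comp z₀ (d2.comp z₀ d1))).deriv
    have hnorm : ∀ c : ℂ, ‖c‖ < 1 → ‖1 - conj c * c‖ = 1 - ‖c‖ ^ 2 := by
      intro c hc
      rw [conj_mul', ← ofReal_pow, ← ofReal_one, ← ofReal_sub, norm_real,
        Real.norm_of_nonneg]
      nlinarith [norm_nonneg c]
    have hsn : ‖deriv s (-a)‖ = 1 / (2 * √‖a‖) := by
      have h1 : 2 * ‖b‖ * ‖deriv s (-a)‖ = 1 := by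
        simpa using congrArg norm hs'
      have h2 : √‖a‖ = ‖b‖ := by rw [← hb2, Real.sqrt_sq (norm_nonneg b)]
      have h3 : ‖b‖ ≠ 0 := fun h ↦ by simp [h] at h1
      rw [h2, eq_div_iff (by simpa using h3)]
      linarith
    have hderiv : deriv (fun z ↦ moebius b (s (moebius a (f z)))) z₀ =
        (1 - conj b * b) / (1 - conj b * b) ^ 2 *
          (deriv s (-a) * ((1 - conj a * a) * deriv f z₀)) := key
    rw [hderiv, norm_mul, norm_mul, norm_mul, norm_div, norm_pow, hnorm a ha, hnorm b hb1, hsn,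
      hb2]
    have h1 : 1 - ‖a‖ ≠ 0 := by linarith
    have h2 : √‖a‖ ≠ 0 := (Real.sqrt_pos.2 (norm_pos_iff.2 ha0)).ne'
    field_simp
    ring

lemma IsAdmissible.norm_deriv_le {U : Set ℂ} {z₀ : ℂ} {r : ℝ} (hr : 0 < r)
    (hrU : ball z₀ r ⊆ U) {f : ℂ → ℂ} (hf : IsAdmissible U z₀ f) :
    ‖deriv f z₀‖ ≤ 1 / r :=
  norm_deriv_le_div_of_mapsTo_ball (hf.diff.mono hrU)
    (by rw [hf.zero]; exact (hf.maps.mono_left hrU).mono_right ball_subset_closedBall) hr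

lemma exists_isAdmissible {U : Set ℂ} (hb : Bornology.IsBounded U)
    (hc : IsPreconnected Uᶜ) (z₀ : ℂ) :
    ∃ f, IsAdmissible U z₀ f ∧ deriv f z₀ ≠ 0 := by
  obtain ⟨R, hR, hUR⟩ : ∃ R : ℝ, 0 < R ∧ U ⊆ ball z₀ R :=
    let ⟨R, hR⟩ := hb.subset_ball_lt 0 z₀
    ⟨R, hR⟩
  have hRne : (R : ℂ) ≠ 0 := by exact_mod_cast hR.ne'
  set f : ℂ → ℂ := fun z ↦ (z - z₀) / R with hf
  have hfi : Function.Injective f := fun x y h ↦ by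
    simpa [hf, div_left_inj' hRne] using h
  have hmaps : MapsTo f U (ball 0 1) := by
    intro z hz
    have := hUR hz
    rw [mem_ball, dist_eq_norm] at this
    rwa [mem_ball_zero_iff, norm_div, norm_real, Real.norm_of_nonneg hR.le, div_lt_one hR]
  refine ⟨f, ⟨by fun_prop, ⟨fun w ↦ w * R + z₀, by fun_prop, fun z _ ↦ ?_⟩, hmaps,
    by simp [hf], ?_⟩, ?_⟩
  · simp [hf, hRne]
  · have hpos : ∀ z : ℂ, 0 < max 1 ‖z‖ := fun z ↦ by positivity
    have hcont : Continuous fun z ↦ f z / (max 1 ‖f z‖ : ℝ) := by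
      have : Continuous f := by fun_prop
      refine this.div (by fun_prop) fun z ↦ ?_
      exact_mod_cast (hpos (f z)).ne'
    convert hc.image _ hcont.continuousOn using 1
    ext w
    constructor
    · rintro ⟨hw, hwU⟩
      rw [mem_closedBall_zero_iff] at hw
      have hfw : f (w * R + z₀) = w := by simp [hf, hRne]
      refine ⟨w * R + z₀, fun h ↦ hwU ⟨_, h, hfw⟩, ?_⟩
      simp only [hfw, max_eq_left hw]
      simp
    · rintro ⟨z, hz, rfl⟩
      constructor
      · rw [mem_closedBall_zero_iff, norm_div, norm_real, Real.norm_of_nonneg (hpos _).le,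
          div_le_one (hpos _)]
        exact le_max_right _ _
      · rintro ⟨x, hx, hxz⟩
        rcases le_total ‖f z‖ 1 with h | h
        · simp only [max_eq_left h] at hxz
          exact hz (hfi (by simpa using hxz) ▸ hx)
        · simp only [max_eq_right h] at hxz
          have h1 := mem_ball_zero_iff.1 (hmaps hx)
          have h0 : ‖f z‖ ≠ 0 := by positivity
          rw [hxz, norm_div, norm_real, norm_norm, div_self h0] at h1
          exact lt_irrefl _ h1
  · have : HasDerivAt f (1 / R) z₀ := ((hasDerivAt_id z₀).sub_const z₀).div_const (R : ℂ)
    rw [this.deriv]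
    simpa using hRne

lemma exists_isAdmissible_ball_subset {U : Set ℂ} (hU : IsOpen U) (hUc : IsConnected U)
    (hb : Bornology.IsBounded U) (hc : IsPreconnected Uᶜ) {z₀ : ℂ} (hz₀ : z₀ ∈ U) {ρ : ℝ}
    (hρ0 : 0 < ρ) (hρ : ρ < 1) : ∃ f, IsAdmissible U z₀ f ∧ ball 0 ρ ⊆ f '' U := by
  by_contra! hcon
  obtain ⟨r, hr, hrU⟩ := Metric.isOpen_iff.1 hU z₀ hz₀
  obtain ⟨f₀, hf₀, hf₀'⟩ := exists_isAdmissible hb hc z₀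
  set q := (1 + ρ) / (2 * √ρ) with hq
  have hs0 : 0 < √ρ := Real.sqrt_pos.2 hρ0
  have hsq : √ρ ^ 2 = ρ := Real.sq_sqrt hρ0.le
  have hs1 : √ρ < 1 := by nlinarith
  have hq1 : 1 < q := by
    rw [hq, lt_div_iff₀ (by positivity)]
    nlinarith [mul_pos (sub_pos.2 hs1) (sub_pos.2 hs1)]
  have hstep : ∀ f, IsAdmissible U z₀ f →
      ∃ h, IsAdmissible U z₀ h ∧ q * ‖deriv f z₀‖ ≤ ‖deriv h z₀‖ := by
    intro f hf
    obtain ⟨a, haρ, haf⟩ := not_subset.1 (hcon f hf)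
    rw [mem_ball_zero_iff] at haρ
    obtain ⟨h, hh, hh'⟩ := hf.exists_koebe hU hUc hz₀ (haρ.trans hρ) haf
    refine ⟨h, hh, hh' ▸ mul_le_mul_of_nonneg_right ?_ (norm_nonneg _)⟩
    have ha0 : a ≠ 0 := fun h ↦ haf ⟨z₀, hz₀, by rw [hf.zero, h]⟩
    have ht0 : 0 < √‖a‖ := Real.sqrt_pos.2 (norm_pos_iff.2 ha0)
    have htq : √‖a‖ ^ 2 = ‖a‖ := Real.sq_sqrt (norm_nonneg a)
    have hts : √‖a‖ ≤ √ρ := Real.sqrt_le_sqrt haρ.le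
    rw [hq, div_le_div_iff₀ (by positivity) (by positivity), ← htq, ← hsq,
      Real.sqrt_sq hs0.le, Real.sqrt_sq ht0.le]
    have h1 : √‖a‖ * √ρ ≤ 1 := by nlinarith
    nlinarith [mul_nonneg (sub_nonneg.2 hts) (sub_nonneg.2 h1)]
  have hiter : ∀ n : ℕ, ∃ f, IsAdmissible U z₀ f ∧ q ^ n * ‖deriv f₀ z₀‖ ≤ ‖deriv f z₀‖ := by
    intro n
    induction n with
    | zero => exact ⟨f₀, hf₀, by simp⟩
    | succ n ih =>
      obtain ⟨f, hf, hf'⟩ := ih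
      obtain ⟨h, hh, hh'⟩ := hstep f hf
      refine ⟨h, hh, le_trans ?_ hh'⟩
      rw [pow_succ', mul_assoc]
      exact mul_le_mul_of_nonneg_left hf' (by linarith)
  obtain ⟨n, hn⟩ := pow_unbounded_of_one_lt (1 / r / ‖deriv f₀ z₀‖) hq1
  obtain ⟨f, hf, hf'⟩ := hiter n
  have := hf.norm_deriv_le hr hrU
  rw [div_lt_iff₀ (norm_pos_iff.2 hf₀')] at hn
  linarith

end Koebe

section NormalFamilies

open Filter Topology

lemma exists_tendstoLocallyUniformlyOn {U : Set ℂ} (hU : IsOpen U) {F : ℕ → ℂ → ℂ} {R : ℝ}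
    (hF : ∀ n, DifferentiableOn ℂ (F n) U) (hb : ∀ n, MapsTo (F n) U (closedBall 0 R))
    (l : Ultrafilter ℕ) : ∃ f, TendstoLocallyUniformlyOn F f l U := by
  have hlim : ∀ z ∈ U, ∃ y, Tendsto (fun n ↦ F n z) l (𝓝 y) := by
    intro z hz
    obtain ⟨y, -, hy⟩ := (isCompact_closedBall (0 : ℂ) R).ultrafilter_le_nhds
      (l.map fun n ↦ F n z) 
        (le_principal_iff.2 (Ultrafilter.mem_map.2 (univ_mem' fun n ↦ hb n hz)))
    exact ⟨y, hy⟩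
  choose! f hf using hlim
  refine ⟨f, Metric.tendstoLocallyUniformlyOn_iff.2 fun ε hε z hz ↦ ?_⟩
  obtain ⟨r, hr, hrU⟩ := Metric.isOpen_iff.1 hU z hz
  have hR : 0 ≤ R := by
    have := hb 0 hz
    rw [mem_closedBall_zero_iff] at this
    exact (norm_nonneg _).trans this
  set C := (2 * R + 1) / r with hC
  have hC0 : 0 < C := by positivity
  have hlip : ∀ n, ∀ y ∈ ball z r, dist (F n y) (F n z) ≤ C * dist y z := by
    intro n y hy
    refine Complex.dist_le_div_mul_dist_of_mapsTo_ball ((hF n).mono hrU) ?_ hy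
    intro x hx
    have h1 := hb n (hrU hx)
    have h2 := hb n hz
    rw [mem_closedBall_zero_iff] at h1 h2
    rw [mem_closedBall, dist_eq_norm]
    linarith [norm_sub_le (F n x) (F n z)]
  set δ := min r (ε / (4 * C)) with hδ
  have hδ0 : 0 < δ := by positivity
  have hsmall : ∀ y ∈ ball z δ, C * dist y z ≤ ε / 4 := by
    intro y hy
    have : dist y z ≤ ε / (4 * C) := (mem_ball.1 hy).le.trans (min_le_right _ _)
    rw [le_div_iff₀ (by positivity)] at this
    linarith
  have hsub : ball z δ ⊆ ball z r := ball_subset_ball (min_le_left _ _)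
  refine ⟨ball z δ, mem_nhdsWithin_of_mem_nhds (ball_mem_nhds z hδ0), ?_⟩
  filter_upwards [(hf z hz).eventually (ball_mem_nhds (f z) (by positivity : 0 < ε / 4))]
    with n hn y hy
  have h1 : dist (f y) (f z) ≤ ε / 4 :=
    le_of_tendsto ((hf y (hrU (hsub hy))).dist (hf z hz))
      (Eventually.of_forall fun m ↦ (hlip m y (hsub hy)).trans (hsmall y hy))
  have h2 := (hlip n y (hsub hy)).trans (hsmall y hy)
  have h3 : dist (F n z) (f z) < ε / 4 := hn
  have h4 := dist_triangle4 (f y) (f z) (F n z) (F n y)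
  rw [dist_comm (f z), dist_comm (F n z) (F n y)] at h4
  linarith

/-- Hurwitz's theorem. -/
lemma ne_of_tendstoLocallyUniformlyOn {U : Set ℂ} (hU : IsOpen U) (hUc : IsPreconnected U)
    {l : Filter ℕ} [l.NeBot] {F : ℕ → ℂ → ℂ} {g : ℂ → ℂ}
    (hF : ∀ n, DifferentiableOn ℂ (F n) U) (hFg : TendstoLocallyUniformlyOn F g l U) {c : ℂ}
    (hc : ∀ n, ∀ z ∈ U, F n z ≠ c) {x y : ℂ} (hx : x ∈ U) (hy : y ∈ U) (hxy : g x ≠ g y)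
    {w : ℂ} (hw : w ∈ U) : g w ≠ c := by
  intro hgw
  have hg : DifferentiableOn ℂ g U := hFg.differentiableOn (Eventually.of_forall hF) hU
  have hga : AnalyticOnNhd ℂ g U := hg.analyticOnNhd hU
  rcases (hga w hw).eventually_eq_or_eventually_ne (g := fun _ ↦ c) analyticAt_const with h | h
  · have := hga.eqOn_of_preconnected_of_eventuallyEq analyticOnNhd_const hUc hw h
    exact hxy ((this hx).trans (this hy).symm)
  rw [eventually_nhdsWithin_iff] at h
  obtain ⟨ε, hε, hεU⟩ := Metric.nhds_basis_closedBall.mem_iff.1 (h.and (hU.mem_nhds hw))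
  have hbU : closedBall w ε ⊆ U := fun z hz ↦ (hεU hz).2
  obtain ⟨m, hm0, hm⟩ : ∃ m > 0, ∀ z ∈ sphere w ε, m ≤ ‖g z - c‖ := by
    have hcont : ContinuousOn (fun z ↦ ‖g z - c‖) (sphere w ε) :=
      ((hg.continuousOn.mono (sphere_subset_closedBall.trans hbU)).sub continuousOn_const).norm
    obtain ⟨z, hz, hmin⟩ := (isCompact_sphere w ε).exists_isMinOn
      (NormedSpace.sphere_nonempty.2 hε.le) hcont
    refine ⟨‖g z - c‖, ?_, hmin⟩
    rw [gt_iff_lt, norm_pos_iff, sub_ne_zero]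
    exact (hεU (sphere_subset_closedBall hz)).1 (ne_of_mem_sphere hz hε.ne')
  have hunif := (tendstoLocallyUniformlyOn_iff_forall_isCompact hU).1 hFg _ hbU
    (isCompact_closedBall w ε)
  obtain ⟨n, hn⟩ := (Metric.tendstoUniformlyOn_iff.1 hunif (m / 2) (by positivity)).exists
  have hne : ∀ z ∈ U, F n z - c ≠ 0 := fun z hz ↦ sub_ne_zero.2 (hc n z hz)
  have hmax : ‖(F n w - c)⁻¹‖ ≤ (m / 2)⁻¹ := by
    refine Complex.norm_le_of_forall_mem_frontier_norm_le (f := fun z ↦ (F n z - c)⁻¹)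
      (isBounded_ball (x := w) (r := ε)) ?_ ?_ (subset_closure (mem_ball_self hε))
    · refine DifferentiableOn.diffContOnCl ?_
      rw [closure_ball w hε.ne']
      exact (((hF n).mono hbU).sub_const c).inv fun z hz ↦ hne z (hbU hz)
    · intro z hz
      rw [frontier_ball w hε.ne'] at hz
      rw [norm_inv]
      refine inv_anti₀ (by positivity) ?_
      have h1 := hm z hz
      have h2 := hn z (sphere_subset_closedBall hz)
      rw [dist_eq_norm] at h2
      have h3 := norm_sub_le_norm_sub_add_norm_sub (g z) (F n z) c
      linarith
  have h2 := hn w (mem_closedBall_self hε.le)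
  rw [hgw, dist_eq_norm, norm_sub_rev] at h2
  rw [norm_inv] at hmax
  have := (inv_le_inv₀ (norm_pos_iff.2 (hne w hw)) (by positivity)).1 hmax
  linarith

end NormalFamilies

section RiemannMapping

open Filter Topology

/-- The Riemann mapping theorem for bounded domains with connected complement. -/
theorem exists_riemann_map {U : Set ℂ} (hU : IsOpen U) (hUc : IsConnected U)
    (hb : Bornology.IsBounded U) (hc : IsPreconnected Uᶜ) :
    ∃ g : ℂ → ℂ, DifferentiableOn ℂ g (ball 0 1) ∧ InjOn g (ball 0 1) ∧
      g '' ball 0 1 = U := by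
  obtain ⟨z₀, hz₀⟩ := hUc.nonempty
  obtain ⟨R, hUR⟩ := hb.subset_closedBall 0
  have hpos : ∀ n : ℕ, (0 : ℝ) < 1 - 1 / (n + 2) := fun n ↦ by
    rw [sub_pos, div_lt_one (by positivity)]
    linarith [(Nat.cast_nonneg n : (0 : ℝ) ≤ n)]
  have hlt : ∀ n : ℕ, (1 - 1 / (n + 2) : ℝ) < 1 := fun n ↦ sub_lt_self _ (by positivity)
  choose F hF hFball using fun n : ℕ ↦
    exists_isAdmissible_ball_subset hU hUc hb hc hz₀ (hpos n) (hlt n)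
  choose H hHd hHF using fun n ↦ (hF n).inv
  set r : ℕ → ℝ := fun n ↦ 1 - 1 / (n + 2) with hr
  have hrlim : Tendsto r atTop (𝓝 1) := by
    have h := (tendsto_const_nhds (x := (1 : ℝ))).sub
      ((tendsto_const_nhds (x := (1 : ℝ))).div_atTop
        (tendsto_atTop_add_const_right atTop (2 : ℝ) tendsto_natCast_atTop_atTop))
    simpa [hr] using h
  set l : Ultrafilter ℕ := hyperfilter ℕ
  have hl : (l : Filter ℕ) ≤ atTop := Nat.hyperfilter_le_atTop
  have hrl : Tendsto (fun n ↦ (r n : ℂ)) l (𝓝 1) := by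
    have := (Complex.continuous_ofReal.tendsto 1).comp (hrlim.mono_left hl)
    simpa [Function.comp_def] using this
  set G : ℕ → ℂ → ℂ := fun n w ↦ H n (r n * w) with hG
  have hscale : ∀ n, ∀ w ∈ ball (0 : ℂ) 1, (r n * w : ℂ) ∈ F n '' U := by
    intro n w hw
    refine hFball n ?_
    rw [mem_ball_zero_iff] at hw ⊢
    rw [norm_mul, Complex.norm_real, Real.norm_of_nonneg (hpos n).le]
    exact mul_lt_of_lt_one_right (hpos n) hw
  have hGU : ∀ n, MapsTo (G n) (ball 0 1) U := by
    intro n w hw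
    obtain ⟨z, hz, hzw⟩ := hscale n w hw
    simpa only [hG, ← hzw, hHF n hz] using hz
  have hFG : ∀ n, ∀ w ∈ ball (0 : ℂ) 1, F n (G n w) = r n * w := by
    intro n w hw
    obtain ⟨z, hz, hzw⟩ := hscale n w hw
    simp only [hG, ← hzw, hHF n hz]
  have hGd : ∀ n, DifferentiableOn ℂ (G n) (ball 0 1) := fun n ↦
    (hHd n).comp (by fun_prop) (hscale n)
  obtain ⟨f, hf⟩ := exists_tendstoLocallyUniformlyOn hU (fun n ↦ (hF n).diff)
    (fun n ↦ (hF n).maps.mono_right ball_subset_closedBall) l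
  obtain ⟨g, hg⟩ := exists_tendstoLocallyUniformlyOn isOpen_ball hGd
    (fun n ↦ (hGU n).mono_right hUR) l
  have hfd : DifferentiableOn ℂ f U :=
    hf.differentiableOn (Eventually.of_forall fun n ↦ (hF n).diff) hU
  have hgd : DifferentiableOn ℂ g (ball 0 1) :=
    hg.differentiableOn (Eventually.of_forall hGd) isOpen_ball
  have hfle : ∀ z ∈ U, ‖f z‖ ≤ 1 := fun z hz ↦
    le_of_tendsto (hf.tendsto_at hz).norm (Eventually.of_forall fun n ↦
      (mem_ball_zero_iff.1 ((hF n).maps hz)).le)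
  have hf0 : f z₀ = 0 := by
    refine tendsto_nhds_unique (hf.tendsto_at hz₀) ?_
    simp only [(hF _).zero]
    exact tendsto_const_nhds
  have hf1 : ∀ z ∈ U, f z ∈ ball (0 : ℂ) 1 := by
    intro z hz
    rw [mem_ball_zero_iff]
    refine (hfle z hz).lt_of_ne fun h ↦ ?_
    have := Complex.norm_eqOn_of_isPreconnected_of_isMaxOn hUc.isPreconnected hU hfd hz
      (fun x hx ↦ by simpa [h] using hfle x hx) hz₀
    simp [hf0, h] at this
  have hgf : ∀ z ∈ U, g (f z) = z := by
    intro z hz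
    have h1 : Tendsto (fun n ↦ F n z / r n) l (𝓝 (f z)) := by
      have := (hf.tendsto_at hz).div hrl one_ne_zero
      rwa [div_one] at this
    have h2 := hg.tendsto_comp (hgd.continuousOn _ (hf1 z hz)) (hf1 z hz)
      (tendsto_nhdsWithin_iff.2 ⟨h1, h1.eventually (isOpen_ball.mem_nhds (hf1 z hz))⟩)
    refine tendsto_nhds_unique h2 (tendsto_const_nhds.congr fun n ↦ ?_)
    have hne : (r n : ℂ) ≠ 0 := Complex.ofReal_ne_zero.2 (hpos n).ne'
    simp only [hG, mul_div_cancel₀ _ hne]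
    exact (hHF n hz).symm
  have hgU : MapsTo g (ball 0 1) U := by
    intro w hw
    by_contra hcon
    obtain ⟨z₁, hz₁, hne⟩ : ∃ z₁ ∈ U, z₁ ≠ z₀ := by
      by_contra! h
      exact not_isOpen_singleton z₀ ((eq_singleton_iff_unique_mem.2 ⟨hz₀, h⟩) ▸ hU)
    refine ne_of_tendstoLocallyUniformlyOn (c := g w) isOpen_ball
      (convex_ball (0 : ℂ) 1).isPreconnected hGd
      hg (fun n z hz h ↦ hcon (h ▸ hGU n hz)) (hf1 z₁ hz₁) (hf1 z₀ hz₀) ?_ hw rfl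
    rwa [hgf _ hz₁, hgf _ hz₀]
  have hfg : ∀ w ∈ ball (0 : ℂ) 1, f (g w) = w := by
    intro w hw
    have h1 := hg.tendsto_at hw
    have h2 := hf.tendsto_comp (hfd.continuousOn _ (hgU hw)) (hgU hw)
      (tendsto_nhdsWithin_iff.2 ⟨h1, h1.eventually (hU.mem_nhds (hgU hw))⟩)
    refine tendsto_nhds_unique h2 ?_
    simp only [hFG _ w hw]
    simpa using hrl.mul_const w
  refine ⟨g, hgd, fun x hx y hy h ↦ by rw [← hfg x hx, h, hfg y hy], ?_⟩
  exact hgU.image_subset.antisymm fun z hz ↦ ⟨f z, hf1 z hz, hgf z hz⟩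

end RiemannMapping

section LengthArea

open Complex MeasureTheory
open scoped ENNReal

lemma det_smul_one (c : ℂ) : (c • (1 : ℂ →L[ℝ] ℂ)).det = ‖c‖ ^ 2 := by
  have h : ((c • (1 : ℂ →L[ℝ] ℂ) : ℂ →L[ℝ] ℂ) : ℂ →ₗ[ℝ] ℂ) = LinearMap.mulLeft ℝ c := by
    ext; simp
  rw [ContinuousLinearMap.det, h, ← LinearMap.det_toMatrix basisOneI,
    Matrix.det_fin_two, ← normSq_eq_norm_sq, normSq_apply]
  simp [LinearMap.toMatrix_apply]

lemma lintegral_enorm_deriv_sq_lt_top {S : Set ℂ} (hS : IsOpen S) {G : ℂ → ℂ}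
    (hG : DifferentiableOn ℂ G S) (hi : InjOn G S) (hb : Bornology.IsBounded (G '' S)) :
    ∫⁻ w in S, ‖deriv G w‖ₑ ^ 2 < ∞ := by
  have h := lintegral_abs_det_fderiv_eq_addHaar_image volume hS.measurableSet
    (f' := fun w ↦ deriv G w • (1 : ℂ →L[ℝ] ℂ)) (fun w hw ↦
      ((hG.differentiableAt (hS.mem_nhds hw)).hasDerivAt.complexToReal_fderiv).hasFDerivWithinAt)
    hi
  have h2 : ∀ w, ENNReal.ofReal |(deriv G w • (1 : ℂ →L[ℝ] ℂ)).det| = ‖deriv G w‖ₑ ^ 2 := by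
    intro w
    rw [det_smul_one, abs_of_nonneg (by positivity), ENNReal.ofReal_pow (norm_nonneg _),
      ofReal_norm]
  simp only [h2] at h
  rw [h]
  exact hb.measure_lt_top

/-- A lower bound for the area swept by a map oscillating by at least `ε` on a vertical segment
of length at most `π`. -/
lemma le_lintegral_enorm_deriv_sq {G : ℂ → ℂ} {S : Set ℂ} (hS : IsOpen S)
    (hG : DifferentiableOn ℂ G S) {x a b ε : ℝ} (hab : a ≤ b) (hπ : b - a ≤ Real.pi)
    (hseg : ∀ y ∈ Icc a b, (x + y * I : ℂ) ∈ S) (hε : 0 < ε)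
    (hd : ε ≤ ‖G (x + b * I) - G (x + a * I)‖) :
    ENNReal.ofReal (ε ^ 2 / Real.pi) ≤
      ∫⁻ y in Ioc a b, ‖deriv G (x + y * I)‖ₑ ^ 2 := by
  have hpi := Real.pi_pos
  have hderiv : ∀ y ∈ Icc a b,
      HasDerivAt (fun y : ℝ ↦ G (x + y * I)) (deriv G (x + y * I) * I) y := by
    intro y hy
    have h1 : HasDerivAt (fun y : ℝ ↦ (x + y * I : ℂ)) I y := by
      simpa using ((ofRealCLM.hasDerivAt (x := y)).mul_const I).const_add (x : ℂ)
    exact ((hG.differentiableAt (hS.mem_nhds (hseg y hy))).hasDerivAt).comp y h1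
  have hcont : ContinuousOn (fun y : ℝ ↦ deriv G (x + y * I) * I) (Icc a b) :=
    (((hG.deriv hS).continuousOn.comp (f := fun y : ℝ ↦ (x + y * I : ℂ)) (by fun_prop)
      hseg)).mul continuousOn_const
  have hftc := intervalIntegral.integral_eq_sub_of_hasDerivAt (a := a) (b := b)
    (f := fun y : ℝ ↦ G (x + y * I)) (f' := fun y ↦ deriv G (x + y * I) * I)
    (by rwa [uIcc_of_le hab]) (ContinuousOn.intervalIntegrable (by rwa [uIcc_of_le hab]))
  rw [intervalIntegral.integral_of_le hab] at hftc
  have h1 : ENNReal.ofReal ε ≤ ∫⁻ y in Ioc a b, ‖deriv G (x + y * I)‖ₑ := by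
    calc ENNReal.ofReal ε ≤ ‖G (x + b * I) - G (x + a * I)‖ₑ := by
          rw [← ofReal_norm]
          exact ENNReal.ofReal_le_ofReal hd
      _ ≤ ∫⁻ y in Ioc a b, ‖deriv G (x + y * I) * I‖ₑ := by
          rw [← hftc]
          exact enorm_integral_le_lintegral_enorm _
      _ = ∫⁻ y in Ioc a b, ‖deriv G (x + y * I)‖ₑ := by
          have hI : ‖I‖ₑ = 1 := by rw [← ofReal_norm, norm_I, ENNReal.ofReal_one]
          simp [enorm_mul, hI]
  have h2 : ∀ c : ℂ, ‖c‖ₑ ≤ ENNReal.ofReal (Real.pi / (2 * ε)) * ‖c‖ₑ ^ 2 +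
      ENNReal.ofReal (ε / (2 * Real.pi)) := by
    intro c
    rw [← ofReal_norm, ← ENNReal.ofReal_pow (norm_nonneg _), ← ENNReal.ofReal_mul (by positivity),
      ← ENNReal.ofReal_add (by positivity) (by positivity)]
    refine ENNReal.ofReal_le_ofReal ?_
    have : Real.pi / (2 * ε) * ‖c‖ ^ 2 + ε / (2 * Real.pi) - ‖c‖ =
        (Real.pi * ‖c‖ - ε) ^ 2 / (2 * ε * Real.pi) := by
      field_simp
      ring
    have h : 0 ≤ (Real.pi * ‖c‖ - ε) ^ 2 / (2 * ε * Real.pi) := by positivity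
    linarith
  set A := ∫⁻ y in Ioc a b, ‖deriv G (x + y * I)‖ₑ ^ 2 with hA
  have h3 : ENNReal.ofReal ε ≤ ENNReal.ofReal (Real.pi / (2 * ε)) * A +
      ENNReal.ofReal (ε / 2) := by
    calc ENNReal.ofReal ε ≤ ∫⁻ y in Ioc a b, ‖deriv G (x + y * I)‖ₑ := h1
      _ ≤ ∫⁻ y in Ioc a b, (ENNReal.ofReal (Real.pi / (2 * ε)) * ‖deriv G (x + y * I)‖ₑ ^ 2 +
            ENNReal.ofReal (ε / (2 * Real.pi))) := lintegral_mono fun y ↦ h2 _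
      _ = ENNReal.ofReal (Real.pi / (2 * ε)) * A +
            ENNReal.ofReal (ε / (2 * Real.pi)) * ENNReal.ofReal (b - a) := by
          rw [lintegral_add_right _ measurable_const,
            lintegral_const_mul' _ _ ENNReal.ofReal_ne_top, setLIntegral_const, Real.volume_Ioc]
      _ ≤ _ := by
          gcongr
          rw [← ENNReal.ofReal_mul (by positivity)]
          refine ENNReal.ofReal_le_ofReal ?_
          calc ε / (2 * Real.pi) * (b - a) ≤ ε / (2 * Real.pi) * Real.pi := by gcongr
            _ = ε / 2 := by field_simp
  by_contra! hlt
  obtain ⟨t, ht⟩ : ∃ t : NNReal, A = t := ⟨A.toNNReal, (ENNReal.coe_toNNReal hlt.ne_top).symm⟩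
  rw [ht, ← ENNReal.ofReal_coe_nnreal, ENNReal.ofReal_lt_ofReal_iff (by positivity),
    lt_div_iff₀ hpi] at hlt
  rw [ht, ← ENNReal.ofReal_coe_nnreal, ← ENNReal.ofReal_mul (by positivity),
    ← ENNReal.ofReal_add (by positivity) (by positivity),
    ENNReal.ofReal_le_ofReal_iff (by positivity)] at h3
  have h4 : Real.pi / (2 * ε) * t < ε / 2 := by
    rw [div_mul_eq_mul_div, div_lt_iff₀ (by positivity)]
    nlinarith
  linarith

/-- The length-area principle: a univalent map of the disc with bounded image has small
oscillation on suitable arbitrarily small circular arcs around a boundary point. -/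
lemma exists_arc_dist_le {g : ℂ → ℂ} (hg : DifferentiableOn ℂ g (ball 0 1))
    (hi : InjOn g (ball 0 1)) (hb : Bornology.IsBounded (g '' ball 0 1)) {ζ : ℂ} (hζ : ‖ζ‖ = 1)
    {ε δ : ℝ} (hε : 0 < ε) (hδ : 0 < δ) :
    ∃ r, 0 < r ∧ r < δ ∧ ∀ z ∈ ball 0 1 ∩ sphere ζ r, ∀ w ∈ ball 0 1 ∩ sphere ζ r,
      dist (g z) (g w) ≤ ε := by
  by_contra! hcon
  have hζ0 : ζ ≠ 0 := fun h ↦ by simp [h] at hζ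
  set φ : ℂ → ℂ := fun w ↦ ζ * (1 - exp w) with hφ
  set S : Set ℂ := {w | |w.im| < Real.pi / 2 ∧ Real.exp w.re < 2 * Real.cos w.im} with hSdef
  have hS : IsOpen S :=
    (isOpen_lt (f := fun w : ℂ ↦ |w.im|) (g := fun _ ↦ Real.pi / 2)
      (by fun_prop) (by fun_prop)).inter
    (isOpen_lt (f := fun w : ℂ ↦ Real.exp w.re) (g := fun w ↦ 2 * Real.cos w.im)
      (by fun_prop) (by fun_prop))
  have hnorm : ∀ w : ℂ, ‖φ w‖ ^ 2 =
      1 + Real.exp w.re * (Real.exp w.re - 2 * Real.cos w.im) := by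
    intro w
    rw [hφ, norm_mul, hζ, one_mul, ← normSq_eq_norm_sq, normSq_apply]
    simp only [sub_re, sub_im, one_re, one_im, exp_re, exp_im]
    linear_combination (Real.exp w.re) ^ 2 * (Real.sin_sq_add_cos_sq w.im)
  have hφS : MapsTo φ S (ball 0 1) := by
    intro w hw
    have h1 := hnorm w
    have h2 := mul_pos (Real.exp_pos w.re) (sub_pos.2 hw.2)
    rw [mem_ball_zero_iff]
    nlinarith [norm_nonneg (φ w)]
  have hφi : InjOn φ S := by
    intro v hv w hw hvw
    have h1 : exp v = exp w := by
      have := mul_left_cancel₀ hζ0 hvw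
      linear_combination -this
    obtain ⟨hv1, hv2⟩ := abs_lt.1 hv.1
    obtain ⟨hw1, hw2⟩ := abs_lt.1 hw.1
    have hpi := Real.pi_pos
    exact exp_inj_of_neg_pi_lt_of_le_pi (by linarith) (by linarith) (by linarith) (by linarith) h1
  have hφd : Differentiable ℂ φ := by fun_prop
  set G : ℂ → ℂ := fun w ↦ g (φ w) with hGdef
  have hG : DifferentiableOn ℂ G S := hg.comp hφd.differentiableOn hφS
  have hGi : InjOn G S := fun v hv w hw h ↦ hφi hv hw (hi (hφS hv) (hφS hw) h)
  have hGb : Bornology.IsBounded (G '' S) := hb.subset (by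
    rintro _ ⟨w, hw, rfl⟩
    exact ⟨_, hφS hw, rfl⟩)
  have hfin := lintegral_enorm_deriv_sq_lt_top hS hG hGi hGb
  have hlift : ∀ r > 0, ∀ z ∈ ball (0 : ℂ) 1 ∩ sphere ζ r,
      ∃ y : ℝ, (Real.log r + y * I : ℂ) ∈ S ∧ φ (Real.log r + y * I) = z := by
    rintro r hr z ⟨hz, hzr⟩
    have hzr' : ‖1 - z / ζ‖ = r := by
      rw [mem_sphere, dist_eq_norm, norm_sub_rev] at hzr
      rw [one_sub_div hζ0, norm_div, hζ, div_one, hzr]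
    have hz' : ‖z / ζ‖ < 1 := by
      rw [norm_div, hζ, div_one]
      exact mem_ball_zero_iff.1 hz
    have hre : 0 < (1 - z / ζ).re := by
      have := (re_le_norm (z / ζ)).trans_lt hz'
      rw [sub_re, one_re]
      linarith
    have hne : 1 - z / ζ ≠ 0 := fun h ↦ by simp [h] at hre
    have hlog : (Real.log r + (1 - z / ζ).arg * I : ℂ) = log (1 - z / ζ) := by
      rw [log, hzr']
    have hφz : φ (log (1 - z / ζ)) = z := by
      simp only [hφ, exp_log hne]
      field_simp
      ring
    refine ⟨(1 - z / ζ).arg, ?_, by rw [hlog, hφz]⟩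
    rw [hlog]
    have him : |(log (1 - z / ζ)).im| < Real.pi / 2 := by
      rw [log_im, abs_arg_lt_pi_div_two_iff]
      exact Or.inl hre
    refine ⟨him, ?_⟩
    have h1 := hnorm (log (1 - z / ζ))
    rw [hφz] at h1
    have h2 : ‖z‖ < 1 := mem_ball_zero_iff.1 hz
    by_contra! h3
    have := mul_nonneg (Real.exp_pos (log (1 - z / ζ)).re).le (sub_nonneg.2 h3)
    nlinarith [norm_nonneg z]
  have hslice : ∀ x y₁ y₂ : ℝ, (x + y₁ * I : ℂ) ∈ S → (x + y₂ * I : ℂ) ∈ S →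
      ∀ y ∈ Icc y₁ y₂, (x + y * I : ℂ) ∈ S := by
    intro x y₁ y₂ h1 h2 y hy
    simp only [hSdef, mem_ofPred_eq, add_re, add_im, ofReal_re, ofReal_im, mul_re, mul_im, I_re,
      I_im, mul_zero, mul_one, sub_zero, add_zero, zero_add]
      at h1 h2 ⊢
    obtain ⟨h11, h12⟩ := abs_lt.1 h1.1
    obtain ⟨h21, h22⟩ := abs_lt.1 h2.1
    refine ⟨abs_lt.2 ⟨by linarith [hy.1], by linarith [hy.2]⟩, ?_⟩
    have := strictConcaveOn_cos_Icc.concaveOn.min_le_of_mem_Icc ⟨h11.le, h12.le⟩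
      ⟨h21.le, h22.le⟩ hy
    rcases min_le_iff.1 this with h | h <;> linarith [h1.2, h2.2]
  have hlow : ∀ x < Real.log δ, ENNReal.ofReal (ε ^ 2 / Real.pi) ≤
      ∫⁻ y : ℝ, S.indicator (fun w ↦ ‖deriv G w‖ₑ ^ 2) (x + y * I) := by
    intro x hx
    obtain ⟨z, hz, w, hw, hzw⟩ := hcon (Real.exp x) (Real.exp_pos x)
      (by rwa [← Real.lt_log_iff_exp_lt hδ])
    obtain ⟨y₁, hy₁, rfl⟩ := hlift _ (Real.exp_pos x) z hz
    obtain ⟨y₂, hy₂, rfl⟩ := hlift _ (Real.exp_pos x) w hw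
    rw [Real.log_exp] at hy₁ hy₂ hzw
    clear hz hw
    wlog hle : y₁ ≤ y₂ generalizing y₁ y₂
    · exact this y₂ hy₂ y₁ hy₁ (by rwa [dist_comm]) (le_of_not_ge hle)
    have hsub := hslice x y₁ y₂ hy₁ hy₂
    have hlen : y₂ - y₁ ≤ Real.pi := by
      have h1 := (abs_lt.1 hy₁.1).1
      have h2 := (abs_lt.1 hy₂.1).2
      simp at h1 h2
      linarith
    refine (le_lintegral_enorm_deriv_sq hS hG hle hlen hsub hε ?_).trans ?_
    · rw [← dist_eq_norm, dist_comm]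
      exact hzw.le
    · rw [← lintegral_indicator measurableSet_Ioc]
      refine lintegral_mono fun y ↦ ?_
      by_cases hy : y ∈ Ioc y₁ y₂
      · rw [indicator_of_mem hy, indicator_of_mem (hsub y (Ioc_subset_Icc_self hy))]
      · rw [indicator_of_notMem hy]
        exact zero_le
  have hmeas : Measurable (S.indicator (fun w ↦ ‖deriv G w‖ₑ ^ 2)) :=
    ((measurable_deriv G).enorm.pow_const 2).indicator hS.measurableSet
  have hprod : ∫⁻ w in S, ‖deriv G w‖ₑ ^ 2 =
      ∫⁻ x : ℝ, ∫⁻ y : ℝ, S.indicator (fun w ↦ ‖deriv G w‖ₑ ^ 2) (x + y * I) := by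
    rw [← lintegral_indicator hS.measurableSet,
      ← (volume_preserving_equiv_real_prod.symm _).lintegral_comp hmeas,
      Measure.volume_eq_prod, lintegral_prod _ (by fun_prop)]
    simp only [measurableEquivRealProd_symm_apply, mk_eq_add_mul_I]
  refine hfin.ne (top_unique ?_)
  rw [hprod]
  calc (∞ : ℝ≥0∞) = ∫⁻ _ in Iio (Real.log δ), ENNReal.ofReal (ε ^ 2 / Real.pi) := by
        rw [setLIntegral_const, Real.volume_Iio, ENNReal.mul_top]
        have : 0 < ε ^ 2 / Real.pi := div_pos (by positivity) Real.pi_pos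
        exact (ENNReal.ofReal_pos.2 this).ne'
    _ ≤ ∫⁻ x in Iio (Real.log δ), ∫⁻ y : ℝ,
          S.indicator (fun w ↦ ‖deriv G w‖ₑ ^ 2) (x + y * I) :=
        setLIntegral_mono' measurableSet_Iio hlow
    _ ≤ _ := setLIntegral_le_lintegral _ _

end LengthArea

section Caratheodory

open Filter Topology Bornology

lemma IsJordan.exists_arc {γ : ℝ → ℂ} (hγ : IsJordan γ) {η : ℝ} (hη : 0 < η) :
    ∃ ε > 0, ∀ x ∈ range γ, ∃ J ⊆ range γ, IsCompact J ∧ IsPreconnected J ∧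
      J ⊆ closedBall x η ∧ range γ ∩ closedBall x ε ⊆ J := by
  obtain ⟨δ, hδ, hδη⟩ := Metric.uniformContinuousOn_iff.1
    ((isCompact_Icc (a := (-1 : ℝ)) (b := 2)).uniformContinuousOn_of_continuous
      hγ.continuous.continuousOn) η hη
  set δ' := min (δ / 2) (1 / 2) with hδ'
  have hδ'0 : 0 < δ' := by positivity
  have hδ'1 : δ' ≤ 1 / 2 := min_le_right _ _
  have hδ'2 : δ' < δ := (min_le_left _ _).trans_lt (half_lt_self hδ)
  set K : Set (ℝ × ℝ) := (Icc 0 1 ×ˢ Icc (-1) 2) ∩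
    {p | δ' ≤ |p.2 - p.1| ∧ |p.2 - p.1| ≤ 1 / 2} with hK
  have hKc : IsCompact K := (isCompact_Icc.prod isCompact_Icc).inter_right
    ((isClosed_le (f := fun _ : ℝ × ℝ ↦ δ') (g := fun p ↦ |p.2 - p.1|)
      (by fun_prop) (by fun_prop)).inter
    (isClosed_le (f := fun p : ℝ × ℝ ↦ |p.2 - p.1|) (g := fun _ ↦ 1 / 2)
      (by fun_prop) (by fun_prop)))
  have hpos : ∀ p ∈ K, 0 < dist (γ p.2) (γ p.1) := by
    rintro ⟨s, t⟩ ⟨-, h1, h2⟩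
    refine dist_pos.2 fun h ↦ ?_
    obtain ⟨k, hk⟩ := (hγ.eq_iff _ _).1 h
    simp only at h1 h2 hk
    rw [hk, add_sub_cancel_left] at h1 h2
    have hk0 : |k| < 1 := by
      have : (|k| : ℝ) < 1 := by linarith
      exact_mod_cast this
    rw [Int.abs_lt_one_iff] at hk0
    simp only [hk0, Int.cast_zero, abs_zero] at h1
    linarith
  obtain ⟨ε, hε, hεK⟩ : ∃ ε > 0, ∀ p ∈ K, ε < dist (γ p.2) (γ p.1) := by
    rcases K.eq_empty_or_nonempty with h0 | hne
    · exact ⟨1, one_pos, by simp [h0]⟩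
    · obtain ⟨p, hp, hmin⟩ := hKc.exists_isMinOn hne (f := fun p ↦ dist (γ p.2) (γ p.1))
        (by have := hγ.continuous; fun_prop)
      exact ⟨dist (γ p.2) (γ p.1) / 2, half_pos (hpos p hp),
        fun q hq ↦ (half_lt_self (hpos p hp)).trans_le (hmin hq)⟩
  refine ⟨ε, hε, fun x hx ↦ ?_⟩
  rw [← hγ.image_Icc 0] at hx
  obtain ⟨s, hs, rfl⟩ := hx
  rw [zero_add] at hs
  refine ⟨γ '' Icc (s - δ') (s + δ'), image_subset_range _ _,
    isCompact_Icc.image hγ.continuous, isPreconnected_Icc.image _ hγ.continuous.continuousOn,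
    ?_, ?_⟩
  · rintro _ ⟨t, ht, rfl⟩
    refine (hδη t ⟨by linarith [ht.1, hs.1], by linarith [ht.2, hs.2]⟩ s
      ⟨by linarith [hs.1], by linarith [hs.2]⟩ ?_).le
    rw [Real.dist_eq]
    exact (abs_le.2 ⟨by linarith [ht.1], by linarith [ht.2]⟩).trans_lt hδ'2
  · rintro y ⟨hy, hyε⟩
    rw [← hγ.image_Icc (s - 1 / 2)] at hy
    obtain ⟨t, ht, rfl⟩ := hy
    have h2 : |t - s| ≤ 1 / 2 := abs_le.2 ⟨by linarith [ht.1], by linarith [ht.2]⟩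
    refine ⟨t, ?_, rfl⟩
    have h1 : |t - s| ≤ δ' := by
      by_contra! h
      exact (hεK (s, t) ⟨⟨hs, by linarith [ht.1, hs.1], by linarith [ht.2, hs.2]⟩, h.le, h2⟩).not_ge
        hyε
    exact ⟨by linarith [(abs_le.1 h1).1], by linarith [(abs_le.1 h1).2]⟩

/-- A crosscut together with a connected piece of the boundary separates the two sides
of the crosscut. -/
lemma notMem_connectedComponentIn_compl {U V V' E : Set ℂ} (hU : IsPreconnected U)
    (hUo : IsOpen U) (hUb : IsBounded U) (hV : IsOpen V) (hV' : IsOpen V') (hVV' : Disjoint V V')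
    (hVU : V ⊆ U) (hV'U : V' ⊆ U) (hUE : U ⊆ V ∪ V' ∪ E) (hE : IsCompact E)
    (hEU : IsPreconnected (E ∩ frontier U)) {p q : ℂ} (hp : p ∈ V) (hq : q ∈ V') :
    q ∉ connectedComponentIn Eᶜ p := by
  intro hqE
  have hJ : IsCompact (frontier U) :=
    hUb.isCompact_closure.of_isClosed_subset isClosed_frontier frontier_subset_closure
  have hd : U ⊆ (frontier U)ᶜ := disjoint_left.1 (by
    rw [hUo.frontier_eq]
    exact disjoint_sdiff_right)
  have hqJ : q ∈ connectedComponentIn (frontier U)ᶜ p :=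
    hU.subset_connectedComponentIn (hVU hp) hd (hV'U hq)
  have h := mem_connectedComponentIn_compl_union hE hJ hEU hqE hqJ
  have hpc : p ∈ (E ∪ frontier U)ᶜ := by
    by_contra hc
    rw [connectedComponentIn_eq_empty hc] at h
    exact h
  have hcov : connectedComponentIn (E ∪ frontier U)ᶜ p ⊆ V ∪ (V' ∪ (closure U)ᶜ) := by
    intro z hz
    have hz' := connectedComponentIn_subset _ _ hz
    by_cases hzU : z ∈ U
    · rcases hUE hzU with (h | h) | h
      · exact Or.inl h
      · exact Or.inr (Or.inl h)
      · exact absurd (Or.inl h) hz'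
    · refine Or.inr (Or.inr fun hzc ↦ hz' (Or.inr ?_))
      rw [hUo.frontier_eq]
      exact ⟨hzc, hzU⟩
  obtain ⟨z, -, hzV, hz⟩ := isPreconnected_connectedComponentIn V (V' ∪ (closure U)ᶜ) hV
    (hV'.union isClosed_closure.isOpen_compl) hcov ⟨p, mem_connectedComponentIn hpc, hp⟩
    ⟨q, h, Or.inl hq⟩
  rcases hz with hz | hz
  · exact disjoint_left.1 hVV' hzV hz
  · exact hz (subset_closure (hVU hzV))

/-- A holomorphic function on the disc, continuous up to the boundary and vanishing on a
nonempty open arc of the circle, vanishes at the centre. -/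
lemma eq_zero_of_forall_mem_arc {f : ℂ → ℂ} (hf : DiffContOnCl ℂ f (ball 0 1)) {O : Set ℂ}
    (hO : IsOpen O) {ζ : ℂ} (hζ : ‖ζ‖ = 1) (hζO : ζ ∈ O)
    (h0 : ∀ z ∈ O, ‖z‖ = 1 → f z = 0) : f 0 = 0 := by
  obtain ⟨t, ht, hcov⟩ := (isCompact_sphere (0 : ℂ) 1).elim_nhds_subcover
    (fun u ↦ (fun z ↦ ζ / u * z) ⁻¹' O) (fun u hu ↦ (hO.preimage (by fun_prop)).mem_nhds (by
      have : u ≠ 0 := ne_of_mem_sphere hu one_ne_zero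
      simpa [this] using hζO))
  have hn : ∀ u ∈ t, ∀ z, ‖ζ / u * z‖ = ‖z‖ := fun u hu z ↦ by
    rw [norm_mul, norm_div, hζ, mem_sphere_zero_iff_norm.1 (ht u hu), div_one, one_mul]
  have hfu : ∀ u ∈ t, DiffContOnCl ℂ (fun z ↦ f (ζ / u * z)) (ball 0 1) := fun u hu ↦
    have hd : Differentiable ℂ fun z ↦ ζ / u * z := by fun_prop
    hf.comp (hd.diffContOnCl (s := ball 0 1)) fun z hz ↦ by
      rw [mem_ball_zero_iff] at hz ⊢
      rwa [hn u hu]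
  have hH : DiffContOnCl ℂ (fun z ↦ ∏ u ∈ t, f (ζ / u * z)) (ball 0 1) :=
    ⟨DifferentiableOn.fun_finsetProd fun u hu ↦ (hfu u hu).differentiableOn,
      continuousOn_finsetProd _ fun u hu ↦ (hfu u hu).continuousOn⟩
  have h := Complex.eqOn_closure_of_eqOn_frontier isBounded_ball hH
    (diffContOnCl_const (c := 0)) (fun z hz ↦ ?_) (subset_closure (mem_ball_self one_pos))
  · obtain ⟨u, hu, hu0⟩ := Finset.prod_eq_zero_iff.1 h
    simpa using hu0
  · rw [frontier_ball _ one_ne_zero] at hz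
    obtain ⟨u, hu, huz⟩ := mem_iUnion₂.1 (hcov hz)
    refine Finset.prod_eq_zero hu (h0 _ huz ?_)
    rw [hn u hu, mem_sphere_zero_iff_norm.1 hz]

variable {U : Set ℂ} {g : ℂ → ℂ}

lemma isOpen_image_of_injOn_of_isOpen {V : Set ℂ} (hV : IsOpen V) (hg : DifferentiableOn ℂ g V)
    (hi : InjOn g V) : IsOpen (g '' V) := by
  refine isOpen_iff_mem_nhds.2 ?_
  rintro _ ⟨z, hz, rfl⟩
  obtain ⟨ρ, hρ, hρV⟩ := Metric.isOpen_iff.1 hV z hz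
  exact Filter.mem_of_superset ((isOpen_image_of_injOn isOpen_ball (convex_ball z ρ).isPreconnected
    (hg.mono hρV) (hi.mono hρV)).mem_nhds ⟨z, mem_ball_self hρ, rfl⟩) (image_mono hρV)

lemma exists_image_subset_closedBall {γ : ℝ → ℂ} (hγ : IsJordan γ) (hUb : IsBounded U)
    (hUγ : frontier U = range γ) (hg : DifferentiableOn ℂ g (ball 0 1))
    (hi : InjOn g (ball 0 1)) (hgU : g '' ball 0 1 = U) {ζ : ℂ} (hζ : ‖ζ‖ = 1) {η : ℝ}
    (hη : 0 < η) : ∃ r > 0, ∃ c, g '' (ball 0 1 ∩ ball ζ r) ⊆ closedBall c η := by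
  have hopen : ∀ V, IsOpen V → V ⊆ ball 0 1 → IsOpen (g '' V) :=
    fun V hV hVb ↦ isOpen_image_of_injOn_of_isOpen hV (hg.mono hVb) (hi.mono hVb)
  have hUc : IsPreconnected U := by
    rw [← hgU]
    exact (convex_ball (0 : ℂ) 1).isPreconnected.image _ hg.continuousOn
  have hUo : IsOpen U := hgU ▸ hopen _ isOpen_ball Subset.rfl
  have h4 : (1 / 4 : ℂ) ∈ ball (0 : ℂ) 1 := by
    rw [mem_ball_zero_iff]
    norm_num
  have hd : 0 < dist (g 0) (g (1 / 4)) := dist_pos.2 fun h ↦ by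
    have := hi (mem_ball_self one_pos) h4 h
    norm_num at this
  set κ := min (η / 2) (dist (g 0) (g (1 / 4)) / 8) with hκ
  have hκ0 : 0 < κ := by positivity
  have hκ1 : κ ≤ η / 2 := min_le_left _ _
  have hκ2 : κ ≤ dist (g 0) (g (1 / 4)) / 8 := min_le_right _ _
  obtain ⟨ε', hε', hJ'⟩ := hγ.exists_arc hκ0
  set ε := min ε' κ with hε
  have hε0 : 0 < ε := by positivity
  obtain ⟨r, hr, hr2, hrε⟩ := exists_arc_dist_le hg hi (hgU ▸ hUb) hζ (half_pos hε0)
    (half_pos one_pos)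
  set C := ball (0 : ℂ) 1 ∩ sphere ζ r with hC
  set N := ball (0 : ℂ) 1 ∩ ball ζ r with hN
  set N' := ball (0 : ℂ) 1 ∩ (closedBall ζ r)ᶜ with hN'
  have hcl : ∀ x ∈ closure (g '' C), ∀ y ∈ closure (g '' C), dist x y ≤ ε := by
    have h1 : ∀ z ∈ C, closure (g '' C) ⊆ closedBall (g z) (ε / 2) := fun z hz ↦
      closure_minimal (by
        rintro _ ⟨w, hw, rfl⟩
        exact hrε w hw z hz) isClosed_closedBall
    obtain h0 | ⟨z, hz⟩ := C.eq_empty_or_nonempty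
    · simp [h0]
    · intro x hx y hy
      have hx' := mem_closedBall.1 (h1 z hz hx)
      have hy' := mem_closedBall'.1 (h1 z hz hy)
      linarith [dist_triangle x (g z) y]
  have hE0 : IsCompact (closure (g '' C)) :=
    (hUb.subset (hgU ▸ image_mono inter_subset_left)).isCompact_closure
  obtain ⟨E, hE, hCE, hEU, c, hEc⟩ : ∃ E, IsCompact E ∧ g '' C ⊆ E ∧
      IsPreconnected (E ∩ frontier U) ∧ ∃ c, E ⊆ closedBall c (2 * κ) := by
    obtain h0 | ⟨x, hx, hxJ⟩ := (closure (g '' C) ∩ frontier U).eq_empty_or_nonempty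
    · refine ⟨_, hE0, subset_closure, by rw [h0]; exact isPreconnected_empty, ?_⟩
      obtain h0 | ⟨z, hz⟩ := (closure (g '' C)).eq_empty_or_nonempty
      · simp [h0]
      · exact ⟨z, fun y hy ↦ (hcl y hy z hz).trans
          ((min_le_right _ _).trans (by linarith))⟩
    · obtain ⟨J, hJγ, hJc, hJp, hJη, hJε⟩ := hJ' x (hUγ ▸ hxJ)
      refine ⟨closure (g '' C) ∪ J, hE0.union hJc, subset_closure.trans subset_union_left, ?_,
        x, union_subset ?_ (hJη.trans (closedBall_subset_closedBall (by linarith)))⟩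
      · convert hJp using 1
        rw [union_inter_distrib_right, hUγ, inter_eq_left.2 hJγ, union_eq_right]
        exact fun y hy ↦ hJε ⟨hy.2, (hcl y hy.1 x hx).trans (min_le_left _ _)⟩
      · exact fun y hy ↦ (hcl y hy x hx).trans ((min_le_right _ _).trans (by linarith))
  have hNN' : Disjoint (g '' N) (g '' N') := by
    refine disjoint_left.2 ?_
    rintro _ ⟨z, hz, rfl⟩ ⟨w, hw, hwz⟩
    rw [hi hw.1 hz.1 hwz] at hw
    exact hw.2 (ball_subset_closedBall hz.2)
  have hcov : U ⊆ g '' N ∪ g '' N' ∪ E := by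
    rw [← hgU]
    rintro _ ⟨z, hz, rfl⟩
    rcases lt_trichotomy (dist z ζ) r with h | h | h
    · exact Or.inl (Or.inl ⟨z, ⟨hz, h⟩, rfl⟩)
    · exact Or.inr (hCE ⟨z, ⟨hz, h⟩, rfl⟩)
    · exact Or.inl (Or.inr ⟨z, ⟨hz, not_le.2 h⟩, rfl⟩)
  have hsep : ∀ p ∈ g '' N, ∀ q ∈ g '' N', q ∉ connectedComponentIn Eᶜ p := fun p hp q hq ↦
    notMem_connectedComponentIn_compl hUc hUo hUb
      (hopen _ (isOpen_ball.inter isOpen_ball) inter_subset_left)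
      (hopen _ (isOpen_ball.inter isClosed_closedBall.isOpen_compl) inter_subset_left) hNN'
      (hgU ▸ image_mono inter_subset_left) (hgU ▸ image_mono inter_subset_left) hcov hE hEU
      hp hq
  refine ⟨r, hr, c, ?_⟩
  by_contra hcon
  obtain ⟨p, hp, hpc⟩ := not_subset.1 hcon
  have hp' : p ∈ (closedBall c (2 * κ))ᶜ := fun h ↦
    hpc (closedBall_subset_closedBall (by linarith) h)
  have hN'c : g '' N' ⊆ closedBall c (2 * κ) := by
    intro q hq
    by_contra hqc
    exact hsep p hp q hq
      ((isPreconnected_compl_closedBall c (by positivity)).subset_connectedComponentIn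
        hp' (compl_subset_compl.2 hEc) hqc)
  have h0N : (0 : ℂ) ∈ N' := ⟨mem_ball_self one_pos, by
    rw [mem_compl_iff, mem_closedBall, dist_zero_left, hζ]
    linarith⟩
  have h4N : (1 / 4 : ℂ) ∈ N' := ⟨h4, by
    rw [mem_compl_iff, mem_closedBall, dist_comm, dist_eq_norm]
    have := norm_sub_norm_le ζ (1 / 4)
    norm_num [hζ] at this ⊢
    linarith⟩
  have h1 := mem_closedBall.1 (hN'c ⟨_, h0N, rfl⟩)
  have h2 := mem_closedBall'.1 (hN'c ⟨_, h4N, rfl⟩)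
  linarith [dist_triangle (g 0) c (g (1 / 4))]

lemma exists_continuousOn_extension {γ : ℝ → ℂ} (hγ : IsJordan γ) (hUb : IsBounded U)
    (hUγ : frontier U = range γ) (hg : DifferentiableOn ℂ g (ball 0 1))
    (hi : InjOn g (ball 0 1)) (hgU : g '' ball 0 1 = U) :
    ∃ G : ℂ → ℂ, ContinuousOn G (closedBall 0 1) ∧ EqOn G g (ball 0 1) := by
  refine ⟨extendFrom (ball 0 1) g, continuousOn_extendFrom ?_ ?_, ?_⟩
  · rw [closure_ball _ one_ne_zero]
  · intro ζ hζ
    rcases (mem_closedBall_zero_iff.1 hζ).lt_or_eq with h | h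
    · exact ⟨g ζ, hg.continuousOn ζ (mem_ball_zero_iff.2 h)⟩
    · have : (𝓝[ball 0 1] ζ).NeBot := by
        rw [← mem_closure_iff_nhdsWithin_neBot, closure_ball _ one_ne_zero]
        exact hζ
      refine cauchy_map_iff_exists_tendsto.1 (Metric.cauchy_iff.2 ⟨inferInstance, fun ε hε ↦ ?_⟩)
      obtain ⟨r, hr, c, hc⟩ := exists_image_subset_closedBall hγ hUb hUγ hg hi hgU h
        (show 0 < ε / 3 by positivity)
      refine ⟨_, image_mem_map (inter_mem self_mem_nhdsWithin
        (mem_nhdsWithin_of_mem_nhds (ball_mem_nhds ζ hr))), fun x hx y hy ↦ ?_⟩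
      have hx' := mem_closedBall.1 (hc hx)
      have hy' := mem_closedBall'.1 (hc hy)
      linarith [dist_triangle x c y]
  · intro z hz
    exact extendFrom_eq (subset_closure hz) (hg.continuousOn z hz)

lemma notMem_of_norm_eq_one {G : ℂ → ℂ} (hG : ContinuousOn G (closedBall 0 1))
    (hg : DifferentiableOn ℂ G (ball 0 1)) (hi : InjOn G (ball 0 1)) {ζ : ℂ} (hζ : ‖ζ‖ = 1) :
    G ζ ∉ G '' ball 0 1 := by
  rintro ⟨z, hz, hzζ⟩
  have hζc : ζ ∈ closedBall (0 : ℂ) 1 := by simp [hζ]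
  rw [mem_ball_zero_iff] at hz
  set ρ := (1 - ‖z‖) / 2 with hρ
  have hρ0 : 0 < ρ := by linarith
  have hsub : ball z ρ ⊆ ball 0 1 := ball_subset_ball' (by rw [dist_zero_right]; linarith)
  have hO := isOpen_image_of_injOn_of_isOpen isOpen_ball (hg.mono hsub) (hi.mono hsub)
  have : (𝓝[ball 0 1] ζ).NeBot := by
    rw [← mem_closure_iff_nhdsWithin_neBot, closure_ball _ one_ne_zero]
    exact hζc
  have h1 : ∀ᶠ w in 𝓝[ball 0 1] ζ, G w ∈ G '' ball z ρ :=
    ((hG ζ hζc).mono ball_subset_closedBall).eventually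
      (hO.mem_nhds ⟨z, mem_ball_self hρ0, hzζ⟩)
  have h2 : ∀ᶠ w in 𝓝[ball 0 1] ζ, w ∈ (closedBall z ρ)ᶜ :=
    mem_nhdsWithin_of_mem_nhds (isClosed_closedBall.isOpen_compl.mem_nhds (by
      rw [mem_compl_iff, mem_closedBall, dist_eq_norm]
      have := norm_sub_norm_le ζ z
      linarith))
  obtain ⟨w, ⟨⟨v, hv, hvw⟩, hw⟩, hwb⟩ := ((h1.and h2).and self_mem_nhdsWithin).exists
  rw [hi (hsub hv) hwb hvw] at hv
  exact hw (ball_subset_closedBall hv)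

lemma exists_chord_functional {ζ₁ ζ₂ : ℂ} (h₁ : ‖ζ₁‖ = 1) (h₂ : ‖ζ₂‖ = 1) (hne : ζ₁ ≠ ζ₂) :
    ∃ l : ℂ → ℝ, Continuous l ∧ (∀ z ∈ ball 0 1, l z = 0 → z ∈ segment ℝ ζ₁ ζ₂) ∧
      (∃ w, ‖w‖ = 1 ∧ 0 < l w) ∧ ∃ w, ‖w‖ = 1 ∧ l w < 0 := by
  set d := ζ₂ - ζ₁ with hd
  have hd0 : 0 < ‖d‖ := norm_pos_iff.2 (sub_ne_zero.2 hne.symm)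
  have hn : ‖d‖ ^ 2 = d.re * d.re + d.im * d.im := by
    rw [← Complex.normSq_eq_norm_sq, Complex.normSq_apply]
  have e₁ : ζ₁.re * ζ₁.re + ζ₁.im * ζ₁.im = 1 := by
    rw [← Complex.normSq_apply, Complex.normSq_eq_norm_sq, h₁, one_pow]
  have e₂ : (ζ₁.re + d.re) * (ζ₁.re + d.re) + (ζ₁.im + d.im) * (ζ₁.im + d.im) = 1 := by
    rw [← Complex.add_re, ← Complex.add_im, ← Complex.normSq_apply, hd, add_sub_cancel,
      Complex.normSq_eq_norm_sq, h₂, one_pow]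
  have hc : |d.re * ζ₁.im - d.im * ζ₁.re| < ‖d‖ := by
    refine abs_lt_of_sq_lt_sq ?_ hd0.le
    have h3 : 2 * (d.re * ζ₁.re + d.im * ζ₁.im) = -‖d‖ ^ 2 := by
      rw [hn]
      linear_combination e₂ - e₁
    have h4 : (d.re * ζ₁.im - d.im * ζ₁.re) ^ 2 + (d.re * ζ₁.re + d.im * ζ₁.im) ^ 2 =
        ‖d‖ ^ 2 := by
      rw [hn]
      linear_combination (d.re * d.re + d.im * d.im) * e₁
    have h5 : 0 < (d.re * ζ₁.re + d.im * ζ₁.im) ^ 2 := by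
      have : d.re * ζ₁.re + d.im * ζ₁.im = -‖d‖ ^ 2 / 2 := by linarith
      rw [this]
      have : 0 < ‖d‖ ^ 2 := by positivity
      nlinarith
    linarith
  obtain ⟨hc1, hc2⟩ := abs_lt.1 hc
  have hu : ‖Complex.I * d / ‖d‖‖ = 1 := by
    rw [norm_div, norm_mul, Complex.norm_I, one_mul, Complex.norm_real, norm_norm,
      div_self hd0.ne']
  have hcross : d.re * (d.re / ‖d‖) + d.im * (d.im / ‖d‖) = ‖d‖ := by
    field_simp
    linarith
  refine ⟨fun z ↦ d.re * (z.im - ζ₁.im) - d.im * (z.re - ζ₁.re), by fun_prop, fun z hz hl ↦ ?_,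
    ⟨Complex.I * d / ‖d‖, hu, ?_⟩, ⟨-(Complex.I * d / ‖d‖), by rw [norm_neg, hu], ?_⟩⟩
  · set t := ((z.re - ζ₁.re) * d.re + (z.im - ζ₁.im) * d.im) / ‖d‖ ^ 2 with ht
    have hre : z.re = ζ₁.re + t * d.re := by
      rw [ht]
      field_simp
      rw [hn]
      linear_combination (-d.im) * hl
    have him : z.im = ζ₁.im + t * d.im := by
      rw [ht]
      field_simp
      rw [hn]
      linear_combination d.re * hl
    have hz' : z.re * z.re + z.im * z.im < 1 := by
      rw [← Complex.normSq_apply, Complex.normSq_eq_norm_sq]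
      exact pow_lt_one₀ (norm_nonneg _) (mem_ball_zero_iff.1 hz) two_ne_zero
    have hlt : ‖d‖ ^ 2 * (t * (1 - t)) > 0 := by
      rw [hre, him] at hz'
      rw [hn]
      linarith [show (ζ₁.re + t * d.re) * (ζ₁.re + t * d.re) +
        (ζ₁.im + t * d.im) * (ζ₁.im + t * d.im) =
          1 - (d.re * d.re + d.im * d.im) * (t * (1 - t)) by
        linear_combination (1 - t) * e₁ + t * e₂]
    have hlt' : 0 < t * (1 - t) := pos_of_mul_pos_right hlt (by positivity)
    rw [segment_eq_image']
    refine ⟨t, ⟨by nlinarith, by nlinarith⟩, ?_⟩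
    apply Complex.ext
    · simp [hre, hd]
    · simp [him, hd]
  · simp only [Complex.div_ofReal_re, Complex.div_ofReal_im, Complex.mul_re, Complex.mul_im,
      Complex.I_re, Complex.I_im]
    ring_nf at hcross ⊢
    linarith
  · simp only [Complex.neg_re, Complex.neg_im, Complex.div_ofReal_re, Complex.div_ofReal_im,
      Complex.mul_re, Complex.mul_im, Complex.I_re, Complex.I_im]
    ring_nf at hcross ⊢
    linarith

lemma injOn_closedBall {γ : ℝ → ℂ} (hγ : IsJordan γ) {G : ℂ → ℂ}
    (hUγ : frontier U = range γ) (hG : ContinuousOn G (closedBall 0 1))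
    (hg : DifferentiableOn ℂ G (ball 0 1)) (hi : InjOn G (ball 0 1)) (hgU : G '' ball 0 1 = U) :
    InjOn G (closedBall 0 1) := by
  have hUo : IsOpen U := hgU ▸ isOpen_image_of_injOn_of_isOpen isOpen_ball hg hi
  have hUc : IsPreconnected U := by
    rw [← hgU]
    exact (convex_ball (0 : ℂ) 1).isPreconnected.image _ hg.continuousOn
  have hcU : G '' closedBall 0 1 ⊆ closure U := by
    rw [← hgU, ← closure_ball _ one_ne_zero]
    exact ContinuousOn.image_closure (by rwa [closure_ball _ one_ne_zero])
  have hUb : IsBounded U := ((isCompact_closedBall _ _).image_of_continuousOn hG).isBounded.subset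
    (hgU ▸ image_mono ball_subset_closedBall)
  have hfr : ∀ ζ, ‖ζ‖ = 1 → G ζ ∈ frontier U := fun ζ hζ ↦ by
    rw [hUo.frontier_eq]
    exact ⟨hcU ⟨ζ, by simp [hζ], rfl⟩, hgU ▸ notMem_of_norm_eq_one hG hg hi hζ⟩
  have hnfr : ∀ z, ‖z‖ < 1 → G z ∉ frontier U := fun z hz ↦ by
    rw [hUo.frontier_eq]
    exact fun h ↦ h.2 (hgU ▸ ⟨z, mem_ball_zero_iff.2 hz, rfl⟩)
  have key : ∀ ζ₁ ζ₂, ‖ζ₁‖ = 1 → ‖ζ₂‖ = 1 → G ζ₁ = G ζ₂ → ζ₁ = ζ₂ := by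
    intro ζ₁ ζ₂ h₁ h₂ h12
    by_contra hne
    obtain ⟨l, hl, hlseg, ⟨w, hw, hlw⟩, w', hw', hlw'⟩ := exists_chord_functional h₁ h₂ hne
    have hm₁ : ζ₁ ∈ closedBall (0 : ℂ) 1 := by simp [h₁]
    have hm₂ : ζ₂ ∈ closedBall (0 : ℂ) 1 := by simp [h₂]
    have hsegb : segment ℝ ζ₁ ζ₂ ⊆ closedBall 0 1 := (convex_closedBall _ _).segment_subset hm₁ hm₂
    set E := G '' segment ℝ ζ₁ ζ₂ with hE
    have hEc : IsCompact E := by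
      refine IsCompact.image_of_continuousOn ?_ (hG.mono hsegb)
      rw [segment_eq_image']
      exact isCompact_Icc.image (by fun_prop)
    have hEfr : E ∩ frontier U = {G ζ₁} := by
      refine Subset.antisymm ?_ (singleton_subset_iff.2
        ⟨⟨ζ₁, left_mem_segment ℝ _ _, rfl⟩, hfr ζ₁ h₁⟩)
      rintro _ ⟨⟨z, hz, rfl⟩, hzf⟩
      rw [← insert_endpoints_openSegment] at hz
      rcases hz with rfl | rfl | hz
      · rfl
      · exact h12.symm
      · exact absurd hzf (hnfr z (mem_ball_zero_iff.1
          (openSegment_subset_ball_of_ne hm₁ hm₂ hne hz)))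
    have hconn : IsPreconnected (frontier U \ {G ζ₁}) := by
      have := hfr ζ₁ h₁
      rw [hUγ] at this ⊢
      obtain ⟨t₀, ht₀⟩ := this
      exact ht₀ ▸ hγ.isPreconnected_range_diff t₀
    have hsubE : frontier U \ {G ζ₁} ⊆ Eᶜ := fun y hy hyE ↦ hy.2 (hEfr ▸ ⟨hyE, hy.1⟩)
    have hPos : IsOpen {z | 0 < l z} := isOpen_lt continuous_const hl
    have hNeg : IsOpen {z | l z < 0} := isOpen_lt hl continuous_const
    have hopen : ∀ O, IsOpen O → IsOpen (G '' (ball 0 1 ∩ O)) := fun O hO ↦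
      isOpen_image_of_injOn_of_isOpen (isOpen_ball.inter hO) (hg.mono inter_subset_left)
        (hi.mono inter_subset_left)
    have hnear : ∀ O, IsOpen O → ∀ ζ ∈ O, ‖ζ‖ = 1 → ∀ W, IsOpen W → G ζ ∈ W →
        ∃ z ∈ ball 0 1 ∩ O, G z ∈ W := by
      intro O hO ζ hζO hζ W hW hζW
      have hζc : ζ ∈ closedBall (0 : ℂ) 1 := by simp [hζ]
      have : (𝓝[ball 0 1] ζ).NeBot := by
        rw [← mem_closure_iff_nhdsWithin_neBot, closure_ball _ one_ne_zero]
        exact hζc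
      obtain ⟨z, ⟨hz1, hz2⟩, hz3⟩ := ((((hG ζ hζc).mono ball_subset_closedBall).eventually
        (hW.mem_nhds hζW)).and (mem_nhdsWithin_of_mem_nhds (hO.mem_nhds hζO))).and
          self_mem_nhdsWithin |>.exists
      exact ⟨z, ⟨hz3, hz2⟩, hz1⟩
    have hsep : ∀ ζ ζ', ‖ζ‖ = 1 → ‖ζ'‖ = 1 → 0 < l ζ → l ζ' < 0 → G ζ ≠ G ζ₁ →
        G ζ' = G ζ₁ := by
      intro ζ ζ' hζ hζ' hlζ hlζ' hGζ
      by_contra hGζ'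
      have hζW := hconn.subset_connectedComponentIn ⟨hfr ζ hζ, hGζ⟩ hsubE ⟨hfr ζ hζ, hGζ⟩
      have hζ'W := hconn.subset_connectedComponentIn ⟨hfr ζ hζ, hGζ⟩ hsubE ⟨hfr ζ' hζ', hGζ'⟩
      have hW : IsOpen (connectedComponentIn Eᶜ (G ζ)) :=
        hEc.isClosed.isOpen_compl.connectedComponentIn
      obtain ⟨z, hz, hzW⟩ := hnear _ hPos ζ hlζ hζ _ hW hζW
      obtain ⟨z', hz', hz'W⟩ := hnear _ hNeg ζ' hlζ' hζ' _ hW hζ'W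
      refine notMem_connectedComponentIn_compl hUc hUo hUb (hopen _ hPos) (hopen _ hNeg) ?_
        (hgU ▸ image_mono inter_subset_left) (hgU ▸ image_mono inter_subset_left) ?_ hEc
        (hEfr ▸ isPreconnected_singleton) ⟨z, hz, rfl⟩ ⟨z', hz', rfl⟩
        (connectedComponentIn_eq hzW ▸ hz'W)
      · refine disjoint_left.2 ?_
        rintro _ ⟨u, hu, rfl⟩ ⟨v, hv, hvu⟩
        rw [hi hv.1 hu.1 hvu] at hv
        exact lt_asymm (show 0 < l u from hu.2) hv.2
      · rw [← hgU]
        rintro _ ⟨u, hu, rfl⟩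
        rcases lt_trichotomy (l u) 0 with h | h | h
        · exact Or.inl (Or.inr ⟨u, ⟨hu, h⟩, rfl⟩)
        · exact Or.inr ⟨u, hlseg u hu h, rfl⟩
        · exact Or.inl (Or.inl ⟨u, ⟨hu, h⟩, rfl⟩)
    have hdiff : DiffContOnCl ℂ (fun z ↦ G z - G ζ₁) (ball 0 1) :=
      ⟨hg.sub_const _, by
        rw [closure_ball _ one_ne_zero]
        exact hG.sub continuousOn_const⟩
    have h0 : G 0 - G ζ₁ = 0 := by
      by_cases h : ∀ z, 0 < l z → ‖z‖ = 1 → G z = G ζ₁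
      · exact eq_zero_of_forall_mem_arc hdiff hPos hw hlw fun z hz hz1 ↦ sub_eq_zero.2 (h z hz hz1)
      · push Not at h
        obtain ⟨ζ, hlζ, hζ, hGζ⟩ := h
        exact eq_zero_of_forall_mem_arc hdiff hNeg hw' hlw' fun z hz hz1 ↦
          sub_eq_zero.2 (hsep ζ z hζ hz1 hlζ hz hGζ)
    exact hnfr 0 (by simp) (sub_eq_zero.1 h0 ▸ hfr ζ₁ h₁)
  intro z hz w hw hzw
  rw [mem_closedBall_zero_iff] at hz hw
  rcases hz.lt_or_eq with hz | hz <;> rcases hw.lt_or_eq with hw | hw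
  · exact hi (mem_ball_zero_iff.2 hz) (mem_ball_zero_iff.2 hw) hzw
  · exact absurd (hzw ▸ hfr w hw) (hnfr z hz)
  · exact absurd (hzw ▸ hfr z hz) (hnfr w hw)
  · exact key z w hz hw hzw

theorem IsJordan.exists_homeomorph {γ : ℝ → ℂ} (hγ : IsJordan γ) :
    ∃ U : Set ℂ, IsOpen U ∧ IsConnected U ∧ IsBounded U ∧ frontier U = range γ ∧
      IsPreconnected (closure U)ᶜ ∧ Nonempty (closure U ≃ₜ closedBall (0 : ℂ) 1) := by
  obtain ⟨U, hUo, hUc, hUb, hUγ, hcl, hUcc⟩ := hγ.exists_interior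
  refine ⟨U, hUo, hUc, hUb, hUγ, hcl, ?_⟩
  obtain ⟨g, hg, hi, hgU⟩ := exists_riemann_map hUo hUc hUb hUcc
  obtain ⟨G, hG, hGg⟩ := exists_continuousOn_extension hγ hUb hUγ hg hi hgU
  have hGU : G '' ball 0 1 = U := by rw [hGg.image_eq, hgU]
  have hGi := injOn_closedBall hγ hUγ hG (hg.congr hGg) (hi.congr hGg.symm) hGU
  have himage : G '' closedBall 0 1 = closure U := by
    refine Subset.antisymm ?_ (closure_minimal (hGU ▸ image_mono ball_subset_closedBall)
      ((isCompact_closedBall _ _).image_of_continuousOn hG).isClosed)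
    rw [← hGU, ← closure_ball _ one_ne_zero]
    exact ContinuousOn.image_closure (by rwa [closure_ball _ one_ne_zero])
  have := isCompact_iff_compactSpace.1 (isCompact_closedBall (0 : ℂ) 1)
  let e : closedBall (0 : ℂ) 1 ≃ closure U :=
    (Equiv.Set.imageOfInjOn G _ hGi).trans (Equiv.setCongr himage)
  have he : Continuous e := hG.domRestrict.subtype_mk _
  exact ⟨(he.homeoOfEquivCompactToT2).symm⟩

end Caratheodory

section Sphere

open Topology Complex

/-- The isometry between the complex numbers and the plane. -/
noncomputable def planeEquiv : ℂ ≃ₗᵢ[ℝ] Plane := orthonormalBasisOneI.repr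

lemma exists_circle_parametrization : ∃ c : ℝ → Circle2, Continuous c ∧ range c = univ ∧
    ∀ s t, c s = c t ↔ ∃ k : ℤ, s = t + k := by
  have hn : ∀ t : ℝ, ‖exp (2 * Real.pi * t * I)‖ = 1 := fun t ↦ by
    rw [show (2 * Real.pi * t * I : ℂ) = (2 * Real.pi * t : ℝ) * I by push_cast; ring,
      norm_exp_ofReal_mul_I]
  refine ⟨fun t ↦ ⟨planeEquiv (exp (2 * Real.pi * t * I)), by
    rw [mem_sphere_zero_iff_norm, LinearIsometryEquiv.norm_map, hn]⟩, ?_, ?_, fun s t ↦ ?_⟩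
  · exact (planeEquiv.continuous.comp (by fun_prop)).subtype_mk _
  · refine eq_univ_of_forall fun z ↦ ?_
    obtain ⟨θ, hθ⟩ := (norm_eq_one_iff (planeEquiv.symm z)).1 (by
      rw [LinearIsometryEquiv.norm_map, mem_sphere_zero_iff_norm.1 z.2])
    refine ⟨θ / (2 * Real.pi), Subtype.ext ?_⟩
    have hpi : (Real.pi : ℂ) ≠ 0 := ofReal_ne_zero.2 Real.pi_ne_zero
    have : (2 * Real.pi * (θ / (2 * Real.pi) : ℝ) * I : ℂ) = θ * I := by
      push_cast
      field_simp
    simp only [this, hθ, LinearIsometryEquiv.apply_symm_apply]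
  · have h2 : (2 * Real.pi * I : ℂ) ≠ 0 := two_pi_I_ne_zero
    rw [Subtype.mk.injEq, planeEquiv.injective.eq_iff, exp_eq_exp_iff_exists_int]
    refine exists_congr fun k ↦ ?_
    rw [show (2 * Real.pi * s * I : ℂ) = s * (2 * Real.pi * I) by ring,
      show (2 * Real.pi * t * I + k * (2 * Real.pi * I) : ℂ) = (t + k) * (2 * Real.pi * I) by ring,
      mul_left_inj' h2]
    norm_cast

lemma exists_isOpenEmbedding (p : Sph) : ∃ e : ℂ → Sph, IsOpenEmbedding e ∧ range e = {p}ᶜ := by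
  have : Fact (Module.finrank ℝ (EuclideanSpace ℝ (Fin 3)) = 2 + 1) := ⟨by simp⟩
  have h := (stereographic' 2 p).symm.isOpenEmbedding
    (by rw [OpenPartialHomeomorph.symm_source, stereographic'_target])
  refine ⟨_, h.comp planeEquiv.toHomeomorph.isOpenEmbedding, ?_⟩
  rw [range_comp, planeEquiv.toHomeomorph.surjective.range_eq, ← stereographic'_source (n := 2) p,
    ← OpenPartialHomeomorph.symm_target, ← OpenPartialHomeomorph.image_source_eq_target,
    OpenPartialHomeomorph.symm_source, stereographic'_target]

lemma range_ne_univ {h : ℝ → Sph} (hc : Continuous h)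
    (hh : ∀ s t, h s = h t ↔ ∃ k : ℤ, s = t + k) : range h ≠ univ := by
  intro hr
  obtain ⟨e, he, her⟩ := exists_isOpenEmbedding (h 0)
  have hne : ∀ s t : ℝ, s < t → t < s + 1 → h s ≠ h t := by
    intro s t hst hts h
    obtain ⟨k, hk⟩ := (hh _ _).1 h
    have h1 : (k : ℝ) < 0 := by linarith
    have h2 : (-1 : ℝ) < k := by linarith
    have h1' : k < 0 := by exact_mod_cast h1
    have h2' : -1 < k := by exact_mod_cast h2
    omega
  obtain ⟨b, hb⟩ : h (1 / 2) ∈ range e := by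
    rw [her]
    exact (hne 0 (1 / 2) (by norm_num) (by norm_num)).symm
  have hconn : IsPreconnected (e '' {b}ᶜ) :=
    (isConnected_compl_singleton_of_one_lt_rank (by rw [rank_real_complex]; norm_num)
      b).isPreconnected.image _ he.continuous.continuousOn
  have hmem : ∀ x, x ∈ e '' {b}ᶜ ↔ x ≠ h 0 ∧ x ≠ h (1 / 2) := by
    intro x
    rw [← hb]
    refine ⟨?_, fun ⟨h0, h1⟩ ↦ ?_⟩
    · rintro ⟨z, hz, rfl⟩
      exact ⟨(her ▸ mem_range_self z : e z ∈ ({h 0}ᶜ : Set Sph)), fun h ↦ hz (he.injective h)⟩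
    · obtain ⟨z, rfl⟩ : x ∈ range e := her ▸ h0
      exact ⟨z, fun h ↦ h1 (congrArg e h), rfl⟩
  obtain ⟨x, hx, ⟨s, hs, hsx⟩, t, ht, htx⟩ := isPreconnected_closed_iff.1 hconn
    (h '' Icc 0 (1 / 2)) (h '' Icc (1 / 2) 1)
    (isCompact_Icc.image hc).isClosed (isCompact_Icc.image hc).isClosed
    (fun x _ ↦ by
      obtain ⟨t, rfl⟩ : x ∈ range h := hr ▸ mem_univ x
      have h1 : h (Int.fract t) = h t := (hh _ _).2 ⟨-⌊t⌋, by push_cast; rfl⟩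
      rw [← h1]
      rcases le_total (Int.fract t) (1 / 2) with h2 | h2
      · exact Or.inl ⟨_, ⟨Int.fract_nonneg t, h2⟩, rfl⟩
      · exact Or.inr ⟨_, ⟨h2, (Int.fract_lt_one t).le⟩, rfl⟩)
    ⟨h (1 / 4), (hmem _).2 ⟨(hne _ _ (by norm_num) (by norm_num)).symm,
      hne _ _ (by norm_num) (by norm_num)⟩, 1 / 4, by constructor <;> norm_num, rfl⟩
    ⟨h (3 / 4), (hmem _).2 ⟨(hne _ _ (by norm_num) (by norm_num)).symm,
      (hne _ _ (by norm_num) (by norm_num)).symm⟩, 3 / 4, by constructor <;> norm_num, rfl⟩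
  rw [hmem] at hx
  have hs1 : s < 1 / 2 := hs.2.lt_of_ne fun h ↦ hx.2 (by rw [← hsx, h])
  have hs0 : 0 < s := hs.1.lt_of_ne fun h ↦ hx.1 (by rw [← hsx, h])
  exact hne s t (by linarith [ht.1]) (by linarith [ht.2]) (hsx.trans htx.symm)

lemma exists_component_of_notMem {h : ℝ → Sph} (hc : Continuous h)
    (hh : ∀ s t, h s = h t ↔ ∃ k : ℤ, s = t + k) {p : Sph} (hp : p ∉ range h) :
    ∃ x ∈ (range h)ᶜ, connectedComponentIn (range h)ᶜ x ≠ connectedComponentIn (range h)ᶜ p ∧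
      (∀ y ∈ (range h)ᶜ, connectedComponentIn (range h)ᶜ y = connectedComponentIn (range h)ᶜ x ∨
        connectedComponentIn (range h)ᶜ y = connectedComponentIn (range h)ᶜ p) ∧
      Nonempty (closure (connectedComponentIn (range h)ᶜ x) ≃ₜ closedBall (0 : Plane) 1) := by
  obtain ⟨e, he, her⟩ := exists_isOpenEmbedding p
  have hlift : ∀ t, ∃ z, e z = h t := fun t ↦ by
    change h t ∈ range e
    rw [her]
    exact fun ht ↦ hp ⟨t, ht⟩
  choose j hj using hlift
  have hej : e ∘ j = h := funext hj
  have hJ : IsJordan j := ⟨he.isEmbedding.continuous_iff.2 (hej ▸ hc), fun s t ↦ by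
    rw [← hh, ← hj, ← hj, he.injective.eq_iff]⟩
  obtain ⟨U, hUo, hUc, hUb, hUj, hcl, ⟨φ⟩⟩ := hJ.exists_homeomorph
  have hrange : range h = e '' frontier U := by rw [hUj, ← range_comp, hej]
  have hclosed : IsClosed (e '' closure U) := (hUb.isCompact_closure.image he.continuous).isClosed
  have hclosure : closure (e '' U) = e '' closure U :=
    Subset.antisymm (closure_minimal (image_mono subset_closure) hclosed)
      (image_closure_subset_closure_image he.continuous)
  set V := (e '' closure U)ᶜ with hV
  have hpe : p ∉ range e := by simp [her]
  have hpV : p ∈ V := fun ⟨z, _, hz⟩ ↦ hpe ⟨z, hz⟩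
  have hpcl : p ∈ closure (range e) := by
    by_contra hpc
    have hcr : IsClosed (range e) := by
      refine closure_subset_iff_isClosed.1 fun x hx ↦ ?_
      rw [her]
      rintro rfl
      exact hpc hx
    refine noncompact_univ ℂ (he.isEmbedding.isCompact_iff.2 ?_)
    rw [image_univ]
    exact hcr.isCompact
  have hVe : V ∩ range e = e '' (closure U)ᶜ := by
    refine Subset.antisymm ?_ ?_
    · rintro _ ⟨hx, z, rfl⟩
      exact ⟨z, fun hz ↦ hx ⟨z, hz, rfl⟩, rfl⟩
    · rintro _ ⟨z, hz, rfl⟩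
      refine ⟨?_, mem_range_self z⟩
      rintro ⟨w, hw, hwz⟩
      exact hz (he.injective hwz ▸ hw)
  have hVc : IsPreconnected V := by
    refine (hcl.image e he.continuous.continuousOn).subset_closure
      (hVe ▸ inter_subset_left) fun x hx ↦ ?_
    rw [← hVe]
    by_cases hxp : x = p
    · exact hclosed.isOpen_compl.inter_closure ⟨hx, hxp ▸ hpcl⟩
    · exact subset_closure ⟨hx, by rw [her]; exact hxp⟩
  have hUV : Disjoint (e '' U) V := disjoint_left.2 fun x hx hxV ↦
    hxV (image_mono subset_closure hx)
  have hcompl : (range h)ᶜ = e '' U ∪ V := by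
    rw [hrange, hV, hUo.frontier_eq, image_sdiff he.injective]
    ext x
    by_cases h1 : x ∈ e '' U
    · simp [h1]
    · simp [h1]
  have hUo' : IsOpen (e '' U) := he.isOpenMap _ hUo
  have hVo : IsOpen V := hclosed.isOpen_compl
  have hUc' : IsPreconnected (e '' U) := hUc.isPreconnected.image _ he.continuous.continuousOn
  rw [hcompl]
  have hCU : ∀ x ∈ e '' U, connectedComponentIn (e '' U ∪ V) x = e '' U := fun x hx ↦
    Subset.antisymm (isPreconnected_connectedComponentIn.subset_left_of_subset_union hUo' hVo hUV
      (connectedComponentIn_subset _ _) ⟨x, mem_connectedComponentIn (Or.inl hx), hx⟩)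
      (hUc'.subset_connectedComponentIn hx subset_union_left)
  have hCV : ∀ x ∈ V, connectedComponentIn (e '' U ∪ V) x = V := fun x hx ↦
    Subset.antisymm (isPreconnected_connectedComponentIn.subset_right_of_subset_union hUo' hVo hUV
      (connectedComponentIn_subset _ _) ⟨x, mem_connectedComponentIn (Or.inr hx), hx⟩)
      (hVc.subset_connectedComponentIn hx subset_union_right)
  obtain ⟨u, hu⟩ := hUc.nonempty
  have hu' : e u ∈ e '' U := ⟨u, hu, rfl⟩
  refine ⟨e u, Or.inl hu', ?_, ?_, ?_⟩
  · rw [hCU _ hu', hCV _ hpV]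
    exact fun h ↦ disjoint_left.1 hUV hu' (h ▸ hu')
  · rw [hCU _ hu', hCV _ hpV]
    exact fun y hy ↦ hy.imp (hCU y) (hCV y)
  · rw [hCU _ hu', hclosure]
    have hball : planeEquiv.toHomeomorph '' closedBall (0 : ℂ) 1 = closedBall (0 : Plane) 1 := by
      simp
    exact ⟨(he.isEmbedding.homeomorphImage _).symm.trans (φ.trans
      ((planeEquiv.toHomeomorph.image _).trans (Homeomorph.setCongr hball)))⟩

end Sphere

end Schoenflies

theorem stmt_18 (γ : Set Sph)
    (hγ : ∃ g : Circle2 → Sph, Continuous g ∧ Function.Injective g ∧ range g = γ) :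
    ∃ U₁ U₂ : Set Sph, U₁ ≠ U₂ ∧
      (∃ x ∈ (γᶜ : Set Sph), U₁ = connectedComponentIn γᶜ x) ∧
      (∃ x ∈ (γᶜ : Set Sph), U₂ = connectedComponentIn γᶜ x) ∧
      (∀ x ∈ (γᶜ : Set Sph), connectedComponentIn γᶜ x = U₁ ∨
        connectedComponentIn γᶜ x = U₂) ∧
      Nonempty ((closure U₁ : Set Sph) ≃ₜ (closedBall (0 : Plane) 1)) ∧
      Nonempty ((closure U₂ : Set Sph) ≃ₜ (closedBall (0 : Plane) 1)) := by
  obtain ⟨g, hg, hgi, rfl⟩ := hγ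
  obtain ⟨c, hc, hcr, hcc⟩ := Schoenflies.exists_circle_parametrization
  have hr : range (g ∘ c) = range g := by rw [range_comp, hcr, image_univ]
  have hh : ∀ s t, (g ∘ c) s = (g ∘ c) t ↔ ∃ k : ℤ, s = t + k := fun s t ↦ by
    rw [← hcc]
    exact hgi.eq_iff
  rw [← hr]
  obtain ⟨p, hp⟩ := (ne_univ_iff_exists_notMem _).1 (Schoenflies.range_ne_univ (hg.comp hc) hh)
  obtain ⟨x, hx, hxp, hcov, hxc⟩ := Schoenflies.exists_component_of_notMem (hg.comp hc) hh hp
  obtain ⟨y, hy, hyx, -, hyc⟩ := Schoenflies.exists_component_of_notMem (hg.comp hc) hh hx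
  exact ⟨_, _, hxp, ⟨x, hx, rfl⟩, ⟨p, hp, rfl⟩, hcov, hxc, (hcov y hy).resolve_left hyx ▸ hyc⟩
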